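/- arXiv:2302.11754 — 5 statements merged into one kernel-verified Lean document; each statement's English description precedes it below -/
import Mathlib

section
/- For every finite non-cyclic group G, the small Davenport constant satisfies d(G) ≤ ⌈|G|/2⌉. -/
/-- A sequence (multiset) over a group is *product-one* if its terms can be
ordered so that their product is `1`. -/
def IsProductOne {G : Type*} [Group G] (S : Multiset G) : Prop :=
  ∃ l : List G, (l : Multiset G) = S ∧ l.prod = 1

/-- A sequence is *product-one free* if no nonempty subsequence is product-one. -/
def ProductOneFree {G : Type*} [Group G] (S : Multiset G) : Prop :=
  ∀ T : Multiset G, T ≤ S → T ≠ 0 → ¬ IsProductOne T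

/-- The small Davenport constant: maximal length of a product-one free sequence. -/
noncomputable def smallDavenport (G : Type*) [Group G] : ℕ :=
  sSup {k : ℕ | ∃ S : Multiset G, Multiset.card S = k ∧ ProductOneFree S}

/-- The Gao constant: the least `ℓ > 0` such that every sequence of length at least `ℓ`
contains a product-one subsequence of length `|G|`. -/
noncomputable def gaoConstant (G : Type*) [Group G] : ℕ :=
  sInf {ℓ : ℕ | 0 < ℓ ∧ ∀ S : Multiset G, ℓ ≤ Multiset.card S →
    ∃ T : Multiset G, T ≤ S ∧ Multiset.card T = Nat.card G ∧ IsProductOne T}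

/-- Relations of the metacyclic group `⟨x, y ∣ x^m = y^n = 1, y*x = x*y^s⟩`. -/
def metacyclicRels (m n : ℕ) (s : ℤ) : Set (FreeGroup (Fin 2)) :=
  {FreeGroup.of 0 ^ m, FreeGroup.of 1 ^ n,
    FreeGroup.of 1 * FreeGroup.of 0 * (FreeGroup.of 0 * FreeGroup.of 1 ^ s)⁻¹}

/-- The metacyclic group `G_{m,n,s} = Cₙ ⋊ₛ Cₘ = ⟨x, y ∣ x^m = y^n = 1, y*x = x*y^s⟩`. -/
abbrev Metacyclic (m n : ℕ) (s : ℤ) : Type := PresentedGroup (metacyclicRels m n s)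

/-- The generator `x` of `G_{m,n,s}`. -/
def mcX (m n : ℕ) (s : ℤ) : Metacyclic m n s := PresentedGroup.of 0

/-- The generator `y` of `G_{m,n,s}`. -/
def mcY (m n : ℕ) (s : ℤ) : Metacyclic m n s := PresentedGroup.of 1

section aux
variable {G : Type*} [Group G]

def subProds (S : Multiset G) : Set G :=
  {x | ∃ l : List G, (l : Multiset G) ≤ S ∧ l.prod = x}

lemma one_mem_subProds (S : Multiset G) : (1 : G) ∈ subProds S :=
  ⟨[], by simp, rfl⟩

lemma subProds_mono {S T : Multiset G} (h : S ≤ T) : subProds S ⊆ subProds T := by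
  rintro x ⟨l, hl, rfl⟩
  exact ⟨l, hl.trans h, rfl⟩

lemma mul_mem_right {T : Multiset G} {x : G} (g : G) (hx : x ∈ subProds T) :
    x * g ∈ subProds (g ::ₘ T) := by
  obtain ⟨l, hl, rfl⟩ := hx
  refine ⟨l ++ [g], ?_, by simp⟩
  rw [← Multiset.coe_add, add_comm]
  exact (Multiset.cons_le_cons_iff g).2 hl

lemma mul_mem_left {T : Multiset G} {x : G} (g : G) (hx : x ∈ subProds T) :
    g * x ∈ subProds (g ::ₘ T) := by
  obtain ⟨l, hl, rfl⟩ := hx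
  refine ⟨g :: l, ?_, by simp⟩
  rw [← Multiset.cons_coe]
  exact (Multiset.cons_le_cons_iff g).2 hl

lemma mem_self {T : Multiset G} {g : G} (h : g ∈ T) : g ∈ subProds T :=
  ⟨[g], by simpa using h, by simp⟩

lemma subProds_sub (S : Multiset G) : subProds S ⊆ Subgroup.closure {x | x ∈ S} := by
  rintro x ⟨l, hl, rfl⟩
  apply Subgroup.list_prod_mem
  intro y hy
  exact Subgroup.subset_closure (Multiset.mem_of_le hl (by simpa using hy))

lemma ProductOneFree.mono {S T : Multiset G} (hS : ProductOneFree S) (h : T ≤ S) :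
    ProductOneFree T := fun U hU => hS U (hU.trans h)

lemma pof_mul_ne_right {T : Multiset G} {g x : G} (hS : ProductOneFree (g ::ₘ T))
    (hx : x ∈ subProds T) : x * g ≠ 1 := by
  obtain ⟨l, hl, rfl⟩ := hx
  intro h
  refine hS (g ::ₘ (l : Multiset G)) ((Multiset.cons_le_cons_iff g).2 hl) (by simp) ⟨l ++ [g], ?_, by simpa using h⟩
  rw [← Multiset.coe_add, add_comm]
  simp

lemma pof_mul_ne_left {T : Multiset G} {g x : G} (hS : ProductOneFree (g ::ₘ T))
    (hx : x ∈ subProds T) : g * x ≠ 1 := by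
  intro h
  apply pof_mul_ne_right hS hx
  rw [mul_eq_one_iff_eq_inv] at h ⊢
  rw [h, inv_inv]

lemma pof_ne_one {S : Multiset G} {g : G} (hS : ProductOneFree S) (hg : g ∈ S) : g ≠ 1 := by
  rintro rfl
  exact hS {1} (by simpa using hg) (by simp) ⟨[1], by simp, by simp⟩

variable [Finite G]

lemma growth {T : Multiset G} {g : G} (hS : ProductOneFree (g ::ₘ T)) :
    (subProds T).ncard + 1 ≤ (subProds (g ::ₘ T)).ncard := by
  by_contra hc
  have h1 : subProds T = subProds (g ::ₘ T) :=
    Set.eq_of_subset_of_ncard_le (subProds_mono (Multiset.le_cons_self _ _)) (by omega)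
      (Set.toFinite _)
  have h2 : (fun x => x * g) '' subProds T = subProds T := by
    apply Set.eq_of_subset_of_ncard_le _ _ (Set.toFinite _)
    · rintro _ ⟨x, hx, rfl⟩
      rw [h1]
      exact mul_mem_right g hx
    · rw [Set.ncard_image_of_injective _ (mul_left_injective g)]
  obtain ⟨x, hx, hx1⟩ := h2.symm ▸ one_mem_subProds T
  exact pof_mul_ne_right hS hx hx1

lemma card_lt {S : Multiset G} (hS : ProductOneFree S) :
    Multiset.card S + 1 ≤ (subProds S).ncard := by
  induction S using Multiset.induction_on with
  | empty =>
    have : 0 < (subProds (0 : Multiset G)).ncard :=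
      (Set.ncard_pos (Set.toFinite _)).2 ⟨1, one_mem_subProds _⟩
    simpa using Nat.succ_le_of_lt this
  | cons g T ih =>
    have := ih (hS.mono (Multiset.le_cons_self _ _))
    have := growth hS
    simp
    omega

lemma double {T : Multiset G} {g : G} (hg : g ∉ Subgroup.closure {x | x ∈ T}) :
    2 * (subProds T).ncard ≤ (subProds (g ::ₘ T)).ncard := by
  have h1 : subProds T ∪ (fun x => g * x) '' subProds T ⊆ subProds (g ::ₘ T) := by
    rintro x (hx | ⟨x, hx, rfl⟩)
    · exact subProds_mono (Multiset.le_cons_self _ _) hx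
    · exact mul_mem_left g hx
  have h2 := Set.ncard_le_ncard h1 (Set.toFinite _)
  rw [Set.ncard_union_eq _ (Set.toFinite _) (Set.toFinite _),
    Set.ncard_image_of_injective _ (mul_right_injective g)] at h2
  · omega
  · rw [Set.disjoint_left]
    rintro _ hx ⟨y, hy, rfl⟩
    exact hg ((Subgroup.mul_mem_cancel_right _ (subProds_sub T hy)).1 (subProds_sub T hx))

lemma key {T : Multiset G} {g : G} (hS : ProductOneFree (g ::ₘ T))
    (hc : (subProds (g ::ₘ T)).ncard = (subProds T).ncard + 1) :
    ∃ z ∈ subProds (g ::ₘ T), subProds T = subProds (g ::ₘ T) \ {z} ∧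
      z ∈ Subgroup.zpowers g ∧
      (∀ x ∈ subProds (g ::ₘ T), x ∉ Subgroup.zpowers g → ∀ w ∈ Subgroup.zpowers g,
        x * w ∈ subProds (g ::ₘ T)) ∧
      (∀ x ∈ subProds (g ::ₘ T), x ≠ 1 → x * g⁻¹ ∈ subProds T ∧ g⁻¹ * x ∈ subProds T) := by
  have hsub : subProds T ⊆ subProds (g ::ₘ T) := subProds_mono (Multiset.le_cons_self _ _)
  have hd : (subProds (g ::ₘ T) \ subProds T).ncard = 1 := by
    rw [Set.ncard_sdiff hsub (Set.toFinite _)]; omega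
  obtain ⟨z, hz⟩ := Set.ncard_eq_one.1 hd
  have hzm : z ∈ subProds (g ::ₘ T) \ subProds T := by rw [hz]; rfl
  have hT : subProds T = subProds (g ::ₘ T) \ {z} := by
    rw [← hz, Set.sdiff_sdiff_cancel_left hsub]
  have hpow : ∀ x ∈ subProds (g ::ₘ T), (∀ n : ℕ, x * g ^ n ≠ z) →
      ∀ n : ℕ, x * g ^ n ∈ subProds T := by
    intro x hx hn n
    induction n with
    | zero => rw [hT]; exact ⟨by simpa using hx, hn 0⟩
    | succ n ih =>
      have := mul_mem_right g ih
      rw [mul_assoc, ← pow_succ] at this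
      rw [hT]; exact ⟨this, hn _⟩
  refine ⟨z, hzm.1, hT, ?_, ?_, ?_⟩
  · by_contra hzg
    have hi : g⁻¹ ∈ Submonoid.powers g := by
      rw [mem_powers_iff_mem_zpowers]; exact inv_mem (Subgroup.mem_zpowers g)
    obtain ⟨n, hn⟩ := hi
    have := hpow 1 (one_mem_subProds _) (by
      rintro m rfl
      apply hzg
      rw [one_mul]
      exact pow_mem (Subgroup.mem_zpowers g) m) n
    simp only at hn
    rw [hn, one_mul] at this
    exact pof_mul_ne_right hS this (by simp)
  · intro x hx hxg w hw
    rw [← mem_powers_iff_mem_zpowers] at hw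
    obtain ⟨n, rfl⟩ := hw
    by_cases hh : ∀ n : ℕ, x * g ^ n ≠ z
    · exact hsub (hpow x hx hh n)
    · exfalso
      push Not at hh
      obtain ⟨m, hm⟩ := hh
      -- the orbit of x avoids z, since z is a power of g
      have hzg : z ∈ Subgroup.zpowers g := by
        by_contra hzg
        have hi : g⁻¹ ∈ Submonoid.powers g := by
          rw [mem_powers_iff_mem_zpowers]; exact inv_mem (Subgroup.mem_zpowers g)
        obtain ⟨n, hn⟩ := hi
        have := hpow 1 (one_mem_subProds _) (by
          rintro m rfl
          apply hzg
          rw [one_mul]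
          exact pow_mem (Subgroup.mem_zpowers g) m) n
        simp only at hn
        rw [hn, one_mul] at this
        exact pof_mul_ne_right hS this (by simp)
      rw [← hm] at hzg
      exact hxg ((Subgroup.mul_mem_cancel_right _ (pow_mem (Subgroup.mem_zpowers g) m)).1 hzg)
  · have c1 : (subProds (g ::ₘ T) \ {1}).ncard = (subProds T).ncard := by
      rw [Set.ncard_sdiff_singleton_of_mem (one_mem_subProds _)]; omega
    have h2 : (fun x => x * g) '' subProds T = subProds (g ::ₘ T) \ {1} := by
      apply Set.eq_of_subset_of_ncard_le _ _ (Set.toFinite _)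
      · rintro _ ⟨x, hx, rfl⟩
        exact ⟨mul_mem_right g hx, pof_mul_ne_right hS hx⟩
      · rw [Set.ncard_image_of_injective _ (mul_left_injective g), c1]
    have h3 : (fun x => g * x) '' subProds T = subProds (g ::ₘ T) \ {1} := by
      apply Set.eq_of_subset_of_ncard_le _ _ (Set.toFinite _)
      · rintro _ ⟨x, hx, rfl⟩
        exact ⟨mul_mem_left g hx, pof_mul_ne_left hS hx⟩
      · rw [Set.ncard_image_of_injective _ (mul_right_injective g), c1]
    intro x hx hx1
    constructor
    · have hm : x ∈ subProds (g ::ₘ T) \ {1} := ⟨hx, hx1⟩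
      rw [← h2] at hm
      obtain ⟨y, hy, rfl⟩ := hm
      simpa using hy
    · have hm : x ∈ subProds (g ::ₘ T) \ {1} := ⟨hx, hx1⟩
      rw [← h3] at hm
      obtain ⟨y, hy, rfl⟩ := hm
      simpa using hy

/-- The degenerate case: removing both `g` and `h` leaves a sequence generating neither. -/
lemma degenerate {R : Multiset G} {g h : G} (hS : ProductOneFree (g ::ₘ h ::ₘ R))
    (hg : g ∉ Subgroup.closure {x | x ∈ R}) (hh : h ∉ Subgroup.closure {x | x ∈ R})
    (cg : (subProds (g ::ₘ R)).ncard ≤ 2 * (subProds R).ncard)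
    (ch : (subProds (h ::ₘ R)).ncard ≤ 2 * (subProds R).ncard)
    (hB : subProds (g ::ₘ h ::ₘ R) ⊆ subProds (g ::ₘ R) ∪ subProds (h ::ₘ R)) : False := by
  have main : ∀ k : G, k ∉ Subgroup.closure {x | x ∈ R} →
      (subProds (k ::ₘ R)).ncard ≤ 2 * (subProds R).ncard →
      ∀ x ∈ subProds (k ::ₘ R), x ∈ subProds R ∨ ∃ y ∈ subProds R, x = k * y := by
    intro k hk ck
    have h1 : subProds R ∪ (fun x => k * x) '' subProds R ⊆ subProds (k ::ₘ R) := by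
      rintro x (hx | ⟨x, hx, rfl⟩)
      · exact subProds_mono (Multiset.le_cons_self _ _) hx
      · exact mul_mem_left k hx
    have h2 : subProds R ∪ (fun x => k * x) '' subProds R = subProds (k ::ₘ R) := by
      apply Set.eq_of_subset_of_ncard_le h1 _ (Set.toFinite _)
      rw [Set.ncard_union_eq _ (Set.toFinite _) (Set.toFinite _),
        Set.ncard_image_of_injective _ (mul_right_injective k)]
      · omega
      · rw [Set.disjoint_left]
        rintro _ hx ⟨y, hy, rfl⟩
        exact hk ((Subgroup.mul_mem_cancel_right _ (subProds_sub R hy)).1 (subProds_sub R hx))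
    intro x hx
    rw [← h2] at hx
    rcases hx with hx | ⟨y, hy, rfl⟩
    · exact Or.inl hx
    · exact Or.inr ⟨y, hy, rfl⟩
  have inC : ∀ x ∈ subProds (g ::ₘ h ::ₘ R), x ∈ Subgroup.closure {x | x ∈ R} →
      x ∈ subProds R := by
    intro x hx hxC
    rcases hB hx with hx | hx
    · rcases main g hg cg x hx with hx | ⟨y, hy, rfl⟩
      · exact hx
      · exact absurd ((Subgroup.mul_mem_cancel_right _ (subProds_sub R hy)).1 hxC) hg
    · rcases main h hh ch x hx with hx | ⟨y, hy, rfl⟩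
      · exact hx
      · exact absurd ((Subgroup.mul_mem_cancel_right _ (subProds_sub R hy)).1 hxC) hh
  have hgh : ∀ d ∈ subProds R, g * h * d ∈ subProds (g ::ₘ h ::ₘ R) := by
    intro d hd
    rw [mul_assoc]
    exact mul_mem_left g (mul_mem_left h hd)
  have notC : g * h ∉ Subgroup.closure {x | x ∈ R} := by
    intro hC
    have e : (fun x => g * h * x) '' subProds R = subProds R := by
      apply Set.eq_of_subset_of_ncard_le _ _ (Set.toFinite _)
      · rintro _ ⟨x, hx, rfl⟩
        exact inC _ (hgh x hx) (mul_mem hC (subProds_sub R hx))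
      · rw [Set.ncard_image_of_injective _ (mul_right_injective _)]
    obtain ⟨d, hd, hd1⟩ := e.symm ▸ one_mem_subProds R
    simp only [mul_assoc] at hd1
    exact pof_mul_ne_left hS (mul_mem_left h hd) hd1
  have h1 : g * h ∈ subProds (g ::ₘ h ::ₘ R) := by
    simpa using hgh 1 (one_mem_subProds R)
  rcases hB h1 with hx | hx
  · rcases main g hg cg _ hx with hx | ⟨y, hy, hx⟩
    · exact notC (subProds_sub R hx)
    · rw [mul_left_cancel hx] at hh
      exact hh (subProds_sub R hy)
  · rcases main h hh ch _ hx with hx | ⟨y, hy, hx⟩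
    · exact notC (subProds_sub R hx)
    · -- `h R = R h`
      have e : (fun x => x * h) '' subProds R = (fun x => h * x) '' subProds R := by
        apply Set.eq_of_subset_of_ncard_le _ _ (Set.toFinite _)
        · rintro _ ⟨x, hx, rfl⟩
          rcases main h hh ch _ (mul_mem_right h hx) with hy | ⟨y, hy, hxy⟩
          · exact absurd ((Subgroup.mul_mem_cancel_left _ (subProds_sub R hx)).1
              (subProds_sub R hy)) hh
          · exact ⟨y, hy, hxy.symm⟩
        · rw [Set.ncard_image_of_injective _ (mul_right_injective _),
            Set.ncard_image_of_injective _ (mul_left_injective _)]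
      have : g * h ∈ (fun x => x * h) '' subProds R := by
        rw [e]; exact ⟨y, hy, hx.symm⟩
      obtain ⟨d, hd, hdx⟩ := this
      rw [← mul_right_cancel hdx] at hg
      exact hg (subProds_sub R hd)

lemma closure_cons_eq {T : Multiset G} {g : G} (hg : g ∈ Subgroup.closure {x | x ∈ T}) :
    Subgroup.closure {x | x ∈ g ::ₘ T} = Subgroup.closure {x | x ∈ T} := by
  apply le_antisymm
  · rw [Subgroup.closure_le]
    intro x hx
    rcases Multiset.mem_cons.1 hx with rfl | hx
    · exact hg
    · exact Subgroup.subset_closure hx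
  · exact Subgroup.closure_mono fun x hx => Multiset.mem_cons_of_mem hx

lemma exists_incomparable {S : Multiset G}
    (hS : ¬ IsCyclic (Subgroup.closure {x | x ∈ S})) :
    ∃ g ∈ S, ∃ h ∈ S, g ∉ Subgroup.zpowers h ∧ h ∉ Subgroup.zpowers g := by
  classical
  have hne : S.toFinset.Nonempty := by
    rw [Finset.nonempty_iff_ne_empty]
    intro h0
    apply hS
    have : S = 0 := by simpa using h0
    subst this
    have : Subgroup.closure {x : G | x ∈ (0 : Multiset G)} = ⊥ := by simp
    rw [this]
    infer_instance
  obtain ⟨g, hg, hmax⟩ := Finset.exists_max_image S.toFinset orderOf hne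
  simp only [Multiset.mem_toFinset] at hg hmax
  by_cases hall : ∀ h ∈ S, h ∈ Subgroup.zpowers g
  · exfalso
    apply hS
    have hle : Subgroup.closure {x | x ∈ S} ≤ Subgroup.zpowers g :=
      (Subgroup.closure_le _).2 hall
    exact isCyclic_of_injective (Subgroup.inclusion hle) (Subgroup.inclusion_injective hle)
  · push Not at hall
    obtain ⟨h, hh, hhg⟩ := hall
    refine ⟨g, hg, h, hh, fun hgh => hhg ?_, hhg⟩
    have hle : Subgroup.zpowers g ≤ Subgroup.zpowers h := by simpa using hgh
    have := Subgroup.eq_of_le_of_card_ge hle (by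
      rw [Nat.card_zpowers, Nat.card_zpowers]; exact hmax h hh)
    rw [this]
    exact Subgroup.mem_zpowers h

lemma comm_of_mem_zpowers {g h : G} (hh : g ∈ Subgroup.zpowers h) : g * h = h * g := by
  obtain ⟨n, rfl⟩ := hh
  exact ((Commute.refl h).zpow_left n).eq

theorem main_bound (n : ℕ) : ∀ S : Multiset G, Multiset.card S = n → ProductOneFree S →
    ¬ IsCyclic (Subgroup.closure {x | x ∈ S}) → 2 * n ≤ (subProds S).ncard := by
  classical
  induction n using Nat.strong_induction_on with
  | _ n ih =>
  intro S hn hS hcyc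
  by_contra hlt
  push Not at hlt
  have step : ∀ g T, S = g ::ₘ T → ¬ IsCyclic (Subgroup.closure {x | x ∈ T}) ∧
      (subProds S).ncard = 2 * n - 1 ∧ (subProds T).ncard = 2 * n - 2 ∧ 1 ≤ n := by
    rintro g T rfl
    have hT := hS.mono (Multiset.le_cons_self T g)
    have hcT : Multiset.card T + 1 = n := by simpa using hn
    have hTc : ¬ IsCyclic (Subgroup.closure {x | x ∈ T}) := by
      intro hTc
      have hg : g ∉ Subgroup.closure {x | x ∈ T} := by
        intro hg
        rw [closure_cons_eq hg] at hcyc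
        exact hcyc hTc
      have := double hg
      have := card_lt hT
      omega
    have h1 := ih (n - 1) (by omega) T (by omega) hT hTc
    have h2 := growth hS
    refine ⟨hTc, ?_, ?_, ?_⟩ <;> omega
  have hz : ∀ g T, S = g ::ₘ T → ∃ z ∈ subProds S, subProds T = subProds S \ {z} ∧
      z ∈ Subgroup.zpowers g ∧
      (∀ x ∈ subProds S, x ∉ Subgroup.zpowers g → ∀ w ∈ Subgroup.zpowers g,
        x * w ∈ subProds S) ∧
      (∀ x ∈ subProds S, x ≠ 1 → x * g⁻¹ ∈ subProds T ∧ g⁻¹ * x ∈ subProds T) := by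
    rintro g T rfl
    apply key hS
    obtain ⟨_, h1, h2, h3⟩ := step g T rfl
    omega
  -- for an incomparable pair, the missing elements differ and the pair commutes
  have pair : ∀ g h R, S = g ::ₘ h ::ₘ R → g ∉ Subgroup.zpowers h → h ∉ Subgroup.zpowers g →
      g * h = h * g ∧ subProds (g ::ₘ R) ≠ subProds (h ::ₘ R) := by
    intro g h R hSR hgh hhg
    have hSR' : S = h ::ₘ g ::ₘ R := by rw [hSR, Multiset.cons_swap]
    have hgS : g ∈ S := by rw [hSR]; simp
    have hhS : h ∈ S := by rw [hSR]; simp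
    have hne : g ≠ h := by rintro rfl; exact hgh (Subgroup.mem_zpowers g)
    obtain ⟨z, hzS, hzT, hzg, hzo, hzi⟩ := hz g _ hSR
    obtain ⟨w, hwS, hwT, hwh, hwo, hwi⟩ := hz h _ hSR'
    have hzn : z ∉ subProds (h ::ₘ R) := by rw [hzT]; simp
    have hwn : w ∉ subProds (g ::ₘ R) := by rw [hwT]; simp
    have hzw : z ≠ w := by
      rintro rfl
      have e1 : h * z = 1 := by
        by_contra hc
        have h1 := hzo h (mem_self hhS) hhg z hzg
        have := (hwi _ h1 hc).2
        rw [inv_mul_cancel_left] at this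
        exact hwn this
      have e2 : g * z = 1 := by
        by_contra hc
        have h1 := hwo g (mem_self hgS) hgh z hwh
        have := (hzi _ h1 hc).2
        rw [inv_mul_cancel_left] at this
        exact hzn this
      exact hne (mul_right_cancel (e2.trans e1.symm))
    refine ⟨?_, ?_⟩
    swap
    · intro he
      rw [he] at hwn
      apply hwn
      rw [hzT]
      exact ⟨hwS, hzw.symm⟩
    obtain ⟨cg, hB, hBh, hn1⟩ := step g _ hSR
    obtain ⟨ch, -, hBg, -⟩ := step h _ hSR'
    have hcR : Multiset.card R + 2 = n := by rw [← hn, hSR]; simp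
    have hR : ProductOneFree R := hS.mono (by
      rw [hSR]; exact (Multiset.le_cons_self _ _).trans (Multiset.le_cons_self _ _))
    by_cases hRc : IsCyclic (Subgroup.closure {x | x ∈ R})
    · exfalso
      have hcl := card_lt hR
      refine degenerate (R := R) (g := g) (h := h) (hSR ▸ hS) ?_ ?_ ?_ ?_ ?_
      · intro hg
        rw [closure_cons_eq hg] at ch
        exact ch hRc
      · intro hg
        rw [closure_cons_eq hg] at cg
        exact cg hRc
      · omega
      · omega
      · rw [← hSR]
        intro x hx
        by_cases hxz : x = z
        · left
          rw [hwT, hxz]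
          exact ⟨hzS, hzw⟩
        · right
          rw [hzT]
          exact ⟨hx, hxz⟩
    · have hRb := ih (n - 2) (by omega) R (by omega) hR hRc
      have hsub : subProds R ⊆ (subProds S \ {z}) \ {w} := by
        intro x hx
        have h1 : x ∈ subProds (h ::ₘ R) := subProds_mono (Multiset.le_cons_self _ _) hx
        have h2 : x ∈ subProds (g ::ₘ R) := subProds_mono (Multiset.le_cons_self _ _) hx
        rw [hzT] at h1
        rw [hwT] at h2
        exact ⟨h1, h2.2⟩
      have hcard : (((subProds S \ {z}) \ {w}) \ subProds R).ncard ≤ 1 := by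
        have hwm : w ∈ subProds S \ {z} := ⟨hwS, hzw.symm⟩
        rw [Set.ncard_sdiff hsub (Set.toFinite _), Set.ncard_sdiff_singleton_of_mem hwm,
          Set.ncard_sdiff_singleton_of_mem hzS]
        omega
      rw [Set.ncard_le_one (Set.toFinite _)] at hcard
      have hg1 : g ≠ 1 := pof_ne_one hS hgS
      have hh1 : h ≠ 1 := pof_ne_one hS hhS
      have hz1 : z ≠ 1 := by rintro rfl; exact hzn (one_mem_subProds _)
      have hw1 : w ≠ 1 := by rintro rfl; exact hwn (one_mem_subProds _)
      have m1 : w * g⁻¹ ∈ ((subProds S \ {z}) \ {w}) \ subProds R := by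
        refine ⟨⟨hzT ▸ (hzi w hwS hw1).1, by simpa using hg1⟩, fun hR' => hwn ?_⟩
        simpa using mul_mem_right g hR'
      have m2 : g⁻¹ * w ∈ ((subProds S \ {z}) \ {w}) \ subProds R := by
        refine ⟨⟨hzT ▸ (hzi w hwS hw1).2, by simpa using hg1⟩, fun hR' => hwn ?_⟩
        simpa using mul_mem_left g hR'
      have m3 : z * h⁻¹ ∈ ((subProds S \ {z}) \ {w}) \ subProds R := by
        have := (hwi z hzS hz1).1
        rw [hwT] at this
        refine ⟨⟨⟨this.1, by simpa using hh1⟩, this.2⟩, fun hR' => hzn ?_⟩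
        simpa using mul_mem_right h hR'
      have m4 : h⁻¹ * z ∈ ((subProds S \ {z}) \ {w}) \ subProds R := by
        have := (hwi z hzS hz1).2
        rw [hwT] at this
        refine ⟨⟨⟨this.1, by simpa using hh1⟩, this.2⟩, fun hR' => hzn ?_⟩
        simpa using mul_mem_left h hR'
      have e1 : w * g⁻¹ = z * h⁻¹ := hcard _ m1 _ m3
      have e2 : z * h⁻¹ = h⁻¹ * z := hcard _ m3 _ m4
      have c1 : Commute w h := comm_of_mem_zpowers hwh
      have c2 : Commute z h := by
        have : Commute z h⁻¹ := e2
        simpa using this.inv_right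
      have c3 : Commute (w * g⁻¹) h := by
        rw [e1]
        exact c2.mul_left (Commute.refl h).inv_left
      have c4 : g = (w * g⁻¹)⁻¹ * w := by group
      have c5 : Commute g h := by
        rw [c4]
        exact c3.inv_left.mul_left c1
      exact c5.eq
  have comm : ∀ g ∈ S, ∀ h ∈ S, Commute g h := by
    intro g hg h hh
    by_cases h1 : g ∈ Subgroup.zpowers h
    · exact comm_of_mem_zpowers h1
    by_cases h2 : h ∈ Subgroup.zpowers g
    · exact (comm_of_mem_zpowers h2 : Commute h g).symm
    have hne : h ≠ g := by rintro rfl; exact h1 (Subgroup.mem_zpowers h)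
    obtain ⟨T, rfl⟩ := Multiset.exists_cons_of_mem hg
    obtain ⟨R, rfl⟩ := Multiset.exists_cons_of_mem ((Multiset.mem_cons.1 hh).resolve_left hne)
    exact (pair g h R rfl h1 h2).1
  have tot : ∀ g T, S = g ::ₘ T → subProds T = subProds S \ {S.toList.prod} := by
    intro g T hST
    obtain ⟨z, hzS, hzT, -⟩ := hz g T hST
    have hw : S.toList.prod ∈ subProds S := ⟨S.toList, by simp, rfl⟩
    have : S.toList.prod = z := by
      by_contra hc
      have hwT : S.toList.prod ∈ subProds T := by rw [hzT]; exact ⟨hw, hc⟩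
      obtain ⟨l, hl, hlp⟩ := hwT
      obtain ⟨R, hR⟩ := Multiset.le_iff_exists_add.1 hl
      have hperm : S.toList.Perm (l ++ g :: R.toList) := by
        rw [← Multiset.coe_eq_coe, Multiset.coe_toList, ← Multiset.coe_add, ← Multiset.cons_coe,
          Multiset.coe_toList, hST, hR, Multiset.add_cons]
      have hpp := hperm.prod_eq' (by
        rw [List.pairwise_iff_forall_sublist]
        intro a b hab
        have := hab.subset
        exact comm a (by simpa using this (by simp)) b (by simpa using this (by simp)))
      rw [List.prod_append, hlp, left_eq_mul] at hpp
      refine hS (g ::ₘ R) ?_ (by simp) ⟨g :: R.toList, by rw [← Multiset.cons_coe]; simp, hpp⟩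
      rw [hST, hR]
      exact Multiset.cons_le_cons _ (Multiset.le_add_left _ _)
    rw [this, hzT]
  obtain ⟨g, hg, h, hh, h1, h2⟩ := exists_incomparable hcyc
  have hne : h ≠ g := by rintro rfl; exact h1 (Subgroup.mem_zpowers h)
  obtain ⟨T, hT⟩ := Multiset.exists_cons_of_mem hg
  have hhT : h ∈ T := by
    rw [hT] at hh
    exact (Multiset.mem_cons.1 hh).resolve_left hne
  obtain ⟨R, rfl⟩ := Multiset.exists_cons_of_mem hhT
  apply (pair g h R hT h1 h2).2
  rw [tot g _ hT, tot h (g ::ₘ R) (by rw [hT, Multiset.cons_swap])]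

end aux

/-- For every finite non-cyclic group `G`, `d(G) ≤ ⌈|G|/2⌉`. -/
theorem davenport_le_half_card (G : Type*) [Group G] [Finite G] (hG : ¬ IsCyclic G) :
    smallDavenport G ≤ (Nat.card G + 1) / 2 := by
  apply csSup_le'
  rintro k ⟨S, rfl, hS⟩
  by_cases hc : IsCyclic (Subgroup.closure {x | x ∈ S})
  · have h1 := card_lt hS
    have h2 := Set.ncard_le_ncard (subProds_sub S) (Set.toFinite _)
    have h3 : ((Subgroup.closure {x | x ∈ S} : Subgroup G) : Set G).ncard
        = Nat.card (Subgroup.closure {x | x ∈ S}) := rfl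
    have h4 := Subgroup.card_mul_index (Subgroup.closure {x | x ∈ S})
    have h5 : (Subgroup.closure {x | x ∈ S}).index ≠ 1 := by
      intro h
      rw [Subgroup.index_eq_one] at h
      rw [h] at hc
      exact hG (isCyclic_of_surjective (Subgroup.topEquiv (G := G)) Subgroup.topEquiv.surjective)
    have h6 : (Subgroup.closure {x | x ∈ S}).index ≠ 0 := Subgroup.index_ne_zero_of_finite
    have h7 : 2 ≤ (Subgroup.closure {x | x ∈ S}).index := by omega
    have h8 := Nat.mul_le_mul_left (Nat.card (Subgroup.closure {x | x ∈ S})) h7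
    omega
  · have h1 := main_bound _ S rfl hS hc
    have h2 := Set.ncard_le_card (subProds S)
    omega
end

section
/- Let m, n be positive integers and let s be an integer with s^m ≡ 1 (mod n), and let G_{m,n,s} = ⟨x, y | x^m = y^n = 1, yx = xy^s⟩ be the corresponding metacyclic group of order mn. Then the sequence over G_{m,n,s} consisting of m−1 copies of x and n−1 copies of y is product-one free; consequently d(G_{m,n,s}) ≥ m + n − 2. -/
lemma mc_free_bound {G : Type*} [Group G] [Finite G] (S : Multiset G) (h : ProductOneFree S) :
    Multiset.card S ≤ Nat.card G := by
  induction S using Quotient.inductionOn with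
  | h l =>
  change ProductOneFree (l : Multiset G) at h
  change l.length ≤ Nat.card G
  by_contra hlt
  push Not at hlt
  have : Fintype G := Fintype.ofFinite G
  obtain ⟨i, j, hij, he⟩ := Fintype.exists_ne_map_eq_of_card_lt
    (fun i : Fin l.length => (l.take i).prod) (by simpa [Nat.card_eq_fintype_card] using hlt)
  wlog hlt' : i < j generalizing i j
  · exact this j i hij.symm he.symm (lt_of_le_of_ne (not_lt.mp hlt') hij.symm)
  have hsplit : l.take j = l.take i ++ (l.take j).drop i := by
    conv_lhs => rw [← List.take_append_drop i (l.take j)]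
    rw [List.take_take, min_eq_left (by exact_mod_cast hlt'.le)]
  rw [hsplit, List.prod_append] at he
  refine h (((l.take j).drop i : List G) : Multiset G) ?_ ?_ ⟨_, rfl, by simpa using he⟩
  · exact Multiset.coe_le.mpr (((List.drop_sublist _ _).trans (List.take_sublist _ _)).subperm)
  · intro h0
    have h1 := congrArg Multiset.card h0
    simp at h1
    have := j.2
    have : (i : ℕ) < j := hlt'
    omega

lemma mc_x_pow (m n : ℕ) (s : ℤ) : mcX m n s ^ m = 1 := by
  have := PresentedGroup.one_of_mem (rels := metacyclicRels m n s)
    (x := FreeGroup.of 0 ^ m) (by simp [metacyclicRels])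
  rwa [map_pow] at this

lemma mc_y_pow (m n : ℕ) (s : ℤ) : mcY m n s ^ n = 1 := by
  have := PresentedGroup.one_of_mem (rels := metacyclicRels m n s)
    (x := FreeGroup.of 1 ^ n) (by simp [metacyclicRels])
  rwa [map_pow] at this

lemma mc_rel (m n : ℕ) (s : ℤ) : mcY m n s * mcX m n s = mcX m n s * mcY m n s ^ s := by
  have := PresentedGroup.one_of_mem (rels := metacyclicRels m n s)
    (x := FreeGroup.of 1 * FreeGroup.of 0 * (FreeGroup.of 0 * FreeGroup.of 1 ^ s)⁻¹)
    (by simp [metacyclicRels])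
  rw [map_mul, map_inv, mul_inv_eq_one, map_mul, map_mul, map_zpow] at this
  exact this

lemma mc_rel_pow (m n : ℕ) (s : ℤ) (k : ℕ) : ∀ j : ℤ,
    mcY m n s ^ j * mcX m n s ^ k = mcX m n s ^ k * mcY m n s ^ (s ^ k * j) := by
  have h1 : ∀ j : ℤ, mcY m n s ^ j * mcX m n s = mcX m n s * mcY m n s ^ (s * j) := by
    intro j
    have h : SemiconjBy (mcX m n s) (mcY m n s ^ s) (mcY m n s) := (mc_rel m n s).symm
    have := (h.zpow_right j).eq
    rw [zpow_mul, this]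
  induction k with
  | zero => simp
  | succ k ih =>
    intro j
    rw [pow_succ, ← mul_assoc, ih, mul_assoc, h1, ← mul_assoc, ← mul_assoc]
    congr 2
    ring

open scoped Pointwise in
lemma mc_finite (m n : ℕ) (s : ℤ) (hm : 0 < m) (hn : 0 < n) : Finite (Metacyclic m n s) := by
  set x := mcX m n s with hx
  set y := mcY m n s with hy
  have hfx : IsOfFinOrder x := isOfFinOrder_iff_pow_eq_one.mpr ⟨m, hm, mc_x_pow m n s⟩
  have hfy : IsOfFinOrder y := isOfFinOrder_iff_pow_eq_one.mpr ⟨n, hn, mc_y_pow m n s⟩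
  have key : ∀ g : Metacyclic m n s, ∃ (i : ℕ) (j : ℤ), g = x ^ i * y ^ j := by
    intro g
    have hg : g ∈ Subgroup.closure (Set.range (PresentedGroup.of (rels := metacyclicRels m n s))) := by
      rw [PresentedGroup.closure_range_of]; trivial
    induction hg using Subgroup.closure_induction_right with
    | one => exact ⟨0, 0, by simp⟩
    | mul_right a ha b hb ih =>
      obtain ⟨i, j, rfl⟩ := ih
      obtain ⟨c, rfl⟩ := hb
      fin_cases c
      · refine ⟨i + 1, s ^ 1 * j, ?_⟩
        have := mc_rel_pow m n s 1 j
        rw [pow_add, mul_assoc, mul_assoc, ← this, pow_one]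
        rfl
      · refine ⟨i, j + 1, ?_⟩
        rw [zpow_add, zpow_one, mul_assoc]
        rfl
    | mul_inv_cancel a ha b hb ih =>
      obtain ⟨i, j, rfl⟩ := ih
      obtain ⟨c, rfl⟩ := hb
      fin_cases c
      · refine ⟨i + (m - 1), s ^ (m - 1) * j, ?_⟩
        have := mc_rel_pow m n s (m - 1) j
        rw [pow_add, mul_assoc, mul_assoc, ← this]
        have h2 : x⁻¹ = x ^ (m - 1) := by
          rw [inv_eq_iff_mul_eq_one, ← pow_succ', Nat.sub_add_cancel hm]
          exact mc_x_pow m n s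
        rw [← hx, ← h2]
        rfl
      · refine ⟨i, j - 1, ?_⟩
        rw [zpow_sub, zpow_one, mul_assoc]
        rfl
  have hfin : ((Subgroup.zpowers x : Set (Metacyclic m n s)) *
      (Subgroup.zpowers y : Set (Metacyclic m n s))).Finite :=
    Set.Finite.mul (by simpa using hfx) (by simpa using hfy)
  refine Set.finite_univ_iff.mp (hfin.subset ?_)
  intro g _
  obtain ⟨i, j, rfl⟩ := key g
  exact Set.mul_mem_mul (Subgroup.npow_mem_zpowers x i) (Subgroup.zpow_mem_zpowers y j)

lemma mc_x_hom (m n : ℕ) (s : ℤ) : ∃ f : Metacyclic m n s →* Multiplicative (ZMod m),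
    f (mcX m n s) = Multiplicative.ofAdd 1 ∧ f (mcY m n s) = 1 := by
  let v : Fin 2 → Multiplicative (ZMod m) := ![Multiplicative.ofAdd 1, 1]
  have hv : ∀ r ∈ metacyclicRels m n s, FreeGroup.lift v r = 1 := by
    rintro r (rfl | rfl | rfl)
    · simp [v, ← ofAdd_nsmul]
    · simp [v]
    · simp [v]
  exact ⟨PresentedGroup.toGroup hv, by simp [mcX, v], by simp [mcY, v]⟩

lemma mc_y_order (m n : ℕ) (s : ℤ) (hm : 0 < m) (hs : (s : ZMod n) ^ m = 1) (b : ℕ)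
    (hb : mcY m n s ^ b = 1) : n ∣ b := by
  let u : (ZMod n)ˣ := Units.ofPowEqOne (s : ZMod n) m hs hm.ne'
  have hu : (u : ZMod n) = s := rfl
  have hum : u ^ m = 1 := Units.ext (by simpa [hu] using hs)
  let X : Equiv.Perm (ZMod n) := MulAction.toPermHom (ZMod n)ˣ (ZMod n) u⁻¹
  let Y : Equiv.Perm (ZMod n) := Equiv.addRight 1
  have hY : ∀ k : ℤ, Y ^ k = Equiv.addRight (k : ZMod n) := by
    intro k
    simp [Y]
  let v : Fin 2 → Equiv.Perm (ZMod n) := ![X, Y]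
  have hv : ∀ r ∈ metacyclicRels m n s, FreeGroup.lift v r = 1 := by
    rintro r (rfl | rfl | rfl)
    · rw [map_pow, FreeGroup.lift_apply_of]
      change X ^ m = 1
      rw [← map_pow, inv_pow, hum, inv_one, map_one]
    · have := hY n
      simp [v]
      rw [← zpow_natCast, this]
      ext; simp
    · rw [map_mul, map_inv, mul_inv_eq_one]
      simp only [map_mul, map_zpow, FreeGroup.lift_apply_of]
      simp only [v, Matrix.cons_val_zero, Matrix.cons_val_one]
      rw [hY]
      ext t
      simp [X, Y, Units.smul_def, mul_add, ← hu]
  have h1 := congrArg (PresentedGroup.toGroup hv) hb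
  have h2 : PresentedGroup.toGroup hv (mcY m n s) = Y := by simp [mcY, v]
  rw [map_pow, h2, map_one, ← zpow_natCast, hY] at h1
  have h3 := congrArg (fun e : Equiv.Perm (ZMod n) => e 0) h1
  simp at h3
  exact (ZMod.natCast_eq_zero_iff b n).mp h3

lemma mc_free (m n : ℕ) (s : ℤ) (hm : 0 < m) (hn : 0 < n)
    (hs : (s : ZMod n) ^ m = 1) :
    ProductOneFree
      (Multiset.replicate (m - 1) (mcX m n s) + Multiset.replicate (n - 1) (mcY m n s)) := by
  classical
  rintro T hT hT0 ⟨l, rfl, hl⟩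
  obtain ⟨A, hA, B, hB, hAB⟩ : ∃ A ≤ Multiset.replicate (m - 1) (mcX m n s),
      ∃ B ≤ Multiset.replicate (n - 1) (mcY m n s), (l : Multiset (Metacyclic m n s)) = A + B :=
    by
      refine ⟨_, Multiset.inter_le_right (s := (l : Multiset _)),
        (l : Multiset _) - Multiset.replicate (m - 1) (mcX m n s), ?_, ?_⟩
      · exact Multiset.sub_le_iff_le_add'.mpr hT
      · rw [add_comm, Multiset.sub_add_inter]
  obtain ⟨a, ha, rfl⟩ := Multiset.le_replicate_iff.mp hA
  obtain ⟨b, hb, rfl⟩ := Multiset.le_replicate_iff.mp hB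
  obtain ⟨f, fx, fy⟩ := mc_x_hom m n s
  have h1 : ((l : Multiset (Metacyclic m n s)).map f).prod = 1 := by
    rw [Multiset.map_coe, Multiset.prod_coe, ← map_list_prod, hl, map_one]
  rw [hAB] at h1
  simp [fx, fy, ← ofAdd_nsmul] at h1
  have h2 : m ∣ a := (ZMod.natCast_eq_zero_iff a m).mp (by simpa using h1)
  have ha0 : a = 0 := Nat.eq_zero_of_dvd_of_lt h2 (by omega)
  subst ha0
  have hlr : l = List.replicate b (mcY m n s) := by
    rw [List.eq_replicate_iff]
    constructor
    · simpa using congrArg Multiset.card hAB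
    · intro c hc
      have : c ∈ (l : Multiset (Metacyclic m n s)) := hc
      rw [hAB] at this
      exact Multiset.eq_of_mem_replicate (by simpa only [Multiset.replicate_zero, zero_add] using this)
  rw [hlr, List.prod_replicate] at hl
  have hb0 : b = 0 := Nat.eq_zero_of_dvd_of_lt (mc_y_order m n s hm hs b hl) (by omega)
  subst hb0
  exact hT0 (by simpa using hAB)

/-- The sequence `x^[m-1] ⬝ y^[n-1]` over `G_{m,n,s}` is product-one free, hence
`d(G_{m,n,s}) ≥ m + n - 2`. -/
theorem davenport_metacyclic_lower (m n : ℕ) (s : ℤ) (hm : 0 < m) (hn : 0 < n)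
    (hs : (s : ZMod n) ^ m = 1) :
    ProductOneFree
      (Multiset.replicate (m - 1) (mcX m n s) + Multiset.replicate (n - 1) (mcY m n s)) ∧
    m + n - 2 ≤ smallDavenport (Metacyclic m n s) := by
  have := mc_finite m n s hm hn
  refine ⟨mc_free m n s hm hn hs, le_csSup ⟨Nat.card (Metacyclic m n s), ?_⟩ ⟨_, ?_, mc_free m n s hm hn hs⟩⟩
  · rintro k ⟨S, rfl, hS⟩
    exact mc_free_bound S hS
  · simp
    omega
end

section
/- Let n ≥ 3 be odd. Then d(G_{4,n,-1}) = 2n and E(G_{4,n,-1}) ≥ 6n; in particular d(G_{4,n,-1}) > 4 + n − 2, so the group G_{4,n,-1} fails the conclusion of Bass' conjecture that d(G_{m,n,s}) = m + n − 2 and E(G_{m,n,s}) = mn + m + n − 2. -/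
section helpers

open QuaternionGroup

lemma hp_isProductOne_map {G H : Type*} [Group G] [Group H] (f : G →* H) {S : Multiset G}
    (h : IsProductOne S) : IsProductOne (S.map f) := by
  obtain ⟨l, hl, hp⟩ := h
  refine ⟨l.map f, ?_, ?_⟩
  · rw [← hl]; rfl
  · rw [← map_list_prod, hp, map_one]

lemma hp_free_map {G H : Type*} [Group G] [Group H] (e : G ≃* H) {S : Multiset G}
    (h : ProductOneFree S) : ProductOneFree (S.map e) := by
  intro T hT hT0 hP
  have h1 := hp_isProductOne_map e.symm.toMonoidHom hP
  refine h _ ?_ ?_ h1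
  · have := Multiset.map_le_map (f := e.symm) hT
    simpa using this
  · simpa using hT0

lemma hp_davenport_congr {G H : Type*} [Group G] [Group H] (e : G ≃* H) :
    smallDavenport G = smallDavenport H := by
  unfold smallDavenport
  congr 1
  ext k
  constructor
  · rintro ⟨S, hS, hf⟩
    exact ⟨S.map e, by simpa using hS, hp_free_map e hf⟩
  · rintro ⟨S, hS, hf⟩
    exact ⟨S.map e.symm, by simpa using hS, hp_free_map e.symm hf⟩

lemma hp_list_filter_prod {G : Type*} [Group G] [DecidableEq G] (l : List G) :
    (l.filter (fun g => g ≠ 1)).prod = l.prod := by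
  induction l with
  | nil => rfl
  | cons g t ih =>
    by_cases hg : g = 1
    · simp [hg] at ih ⊢; exact ih
    · simp [hg] at ih ⊢; exact ih

lemma hp_gao_ge {G : Type*} [Group G] [Finite G] {S : Multiset G} (hS : ProductOneFree S) :
    Nat.card G + Multiset.card S ≤ gaoConstant G := by
  classical
  have : Fintype G := Fintype.ofFinite G
  unfold gaoConstant
  have hpos : 0 < Nat.card G := Nat.card_pos
  apply le_csInf
  · refine ⟨Nat.card G * Nat.card G, by positivity, ?_⟩
    intro S hS
    have : ∃ g : G, Nat.card G ≤ S.count g := by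
      by_contra! hcon
      have h1 : ∑ g : G, S.count g = Multiset.card S := by
        exact Multiset.sum_count_eq_card (fun a _ => Finset.mem_univ a)
      have h2 : ∑ g : G, S.count g < ∑ g : G, Nat.card G :=
        Finset.sum_lt_sum_of_nonempty ⟨1, Finset.mem_univ _⟩ (fun g _ => hcon g)
      simp [← Nat.card_eq_fintype_card] at h2
      omega
    obtain ⟨g, hg⟩ := this
    refine ⟨Multiset.replicate (Nat.card G) g, Multiset.le_count_iff_replicate_le.1 hg, by simp,
      List.replicate (Nat.card G) g, rfl, ?_⟩
    simp
  · rintro ℓ ⟨hℓ, h⟩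
    by_contra! hlt
    obtain ⟨T, hT, hc, l, hl, hp⟩ := h (Multiset.replicate (Nat.card G - 1) 1 + S) (by
      rw [Multiset.card_add, Multiset.card_replicate]; omega)
    have hS1 : (1 : G) ∉ S := by
      intro h1
      exact hS {1} (by simpa using h1) (by simp) ⟨[1], rfl, by simp⟩
    refine hS (T.filter (fun g => g ≠ 1)) ?_ ?_ ⟨l.filter (fun g => g ≠ 1), ?_, ?_⟩
    · have h2 := Multiset.filter_le_filter (fun g => g ≠ 1) hT
      refine h2.trans ?_
      rw [Multiset.filter_add, Multiset.filter_eq_nil.2, zero_add]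
      · exact Multiset.filter_le _ _
      · intro a ha
        simp [Multiset.eq_of_mem_replicate ha]
    · intro h0
      rw [Multiset.filter_eq_nil] at h0
      have h3 : T = Multiset.replicate (Multiset.card T) 1 :=
        Multiset.eq_replicate_card.2 (fun b hb => by simpa using h0 b hb)
      have h4 := Multiset.count_le_of_le (1 : G) hT
      rw [h3] at h4
      rw [Multiset.count_add, Multiset.count_eq_zero_of_notMem hS1, Multiset.count_replicate_self,
        Multiset.count_replicate_self] at h4
      omega
    · rw [← hl]; simp
    · rw [hp_list_filter_prod, hp]

/-- subset sums -/
lemma hp_sums {A : Type*} [AddCommGroup A] [DecidableEq A] (cs : Multiset A)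
    (h : ∀ T ≤ cs, T ≠ 0 → T.sum ≠ 0) :
    Multiset.card cs + 1 ≤ ((cs.powerset.map Multiset.sum).toFinset).card := by
  induction cs using Multiset.induction with
  | empty => simp
  | cons c t ih =>
    have ih := ih (fun T hT => h T (hT.trans (Multiset.le_cons_self _ _)))
    set F := (t.powerset.map Multiset.sum).toFinset with hF
    have hE : (((c ::ₘ t).powerset.map Multiset.sum).toFinset) = F ∪ F.image (fun z => c + z) := by
      ext z
      simp only [hF, Multiset.powerset_cons, Multiset.map_add, Multiset.map_map, Finset.mem_union,
        Multiset.mem_toFinset, Multiset.mem_add, Finset.mem_image, Multiset.mem_map,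
        Function.comp, Multiset.sum_cons, exists_exists_and_eq_and]
    rw [hE, Multiset.card_cons]
    by_contra! hlt
    have hle : F.card ≤ (F ∪ F.image (fun z => c + z)).card :=
      Finset.card_le_card Finset.subset_union_left
    have heq : F = F ∪ F.image (fun z => c + z) :=
      Finset.eq_of_subset_of_card_le Finset.subset_union_left (by omega)
    have hsub : F.image (fun z => c + z) ⊆ F := by
      exact (Finset.subset_union_right (s₁ := F)).trans heq.symm.subset
    have hcard : (F.image (fun z => c + z)).card = F.card :=
      Finset.card_image_of_injective _ (add_right_injective c)
    have heq2 := Finset.eq_of_subset_of_card_le hsub hcard.ge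
    have h0 : (0 : A) ∈ F := by
      simp only [hF, Multiset.mem_toFinset, Multiset.mem_map, Multiset.mem_powerset]
      exact ⟨0, Multiset.zero_le _, by simp⟩
    rw [← heq2, Finset.mem_image] at h0
    obtain ⟨z, hz, hcz⟩ := h0
    simp only [hF, Multiset.mem_toFinset, Multiset.mem_map, Multiset.mem_powerset] at hz
    obtain ⟨T, hT, rfl⟩ := hz
    exact h (c ::ₘ T) ((Multiset.cons_le_cons_iff c).2 hT) (by simp) (by simpa using hcz)

lemma hp_diff {A : Type*} [AddCommGroup A] [Fintype A] [DecidableEq A] (cs : Multiset A)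
    (h : ∀ T ≤ cs, T ≠ 0 → T.sum ≠ 0) (hc : Fintype.card A < 2 * (Multiset.card cs + 1)) (z : A) :
    ∃ T₁ T₂ : Multiset A, T₁ + T₂ ≤ cs ∧ T₁.sum - T₂.sum = z := by
  have hs := hp_sums cs h
  set F := (cs.powerset.map Multiset.sum).toFinset with hF
  have hcard : (F.image (fun w => z + w)).card = F.card :=
    Finset.card_image_of_injective _ (add_right_injective z)
  have : ¬ Disjoint F (F.image (fun w => z + w)) := by
    intro hd
    have h1 := Finset.card_union_of_disjoint hd
    have h2 := Finset.card_le_univ (F ∪ (F.image (fun w => z + w)))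
    omega
  rw [Finset.not_disjoint_iff] at this
  obtain ⟨w, hw1, hw2⟩ := this
  rw [Finset.mem_image] at hw2
  obtain ⟨v, hv, rfl⟩ := hw2
  simp only [hF, Multiset.mem_toFinset, Multiset.mem_map, Multiset.mem_powerset] at hw1 hv
  obtain ⟨T₁, h1, e1⟩ := hw1
  obtain ⟨T₂, h2, e2⟩ := hv
  refine ⟨T₁ - T₂, T₂ - T₁, ?_, ?_⟩
  · rw [Multiset.le_iff_count] at h1 h2 ⊢
    intro a
    have := h1 a
    have := h2 a
    rw [Multiset.count_add, Multiset.count_sub, Multiset.count_sub]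
    omega
  · have a1 : T₁ - T₂ + T₁ ∩ T₂ = T₁ := Multiset.sub_add_inter T₁ T₂
    have a2 : T₂ - T₁ + T₂ ∩ T₁ = T₂ := Multiset.sub_add_inter T₂ T₁
    rw [Multiset.inter_comm] at a2
    have b1 := congrArg Multiset.sum a1
    have b2 := congrArg Multiset.sum a2
    rw [Multiset.sum_add] at b1 b2
    rw [e1] at b1
    rw [e2] at b2
    have b3 : z = ((T₁ - T₂).sum + (T₁ ∩ T₂).sum) - ((T₂ - T₁).sum + (T₁ ∩ T₂).sum) := by
      rw [b1, b2]; abel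
    rw [b3]
    abel

lemma hp_pair {A B : Type*} (f : A → B) (s : Multiset A) (h : ¬ (s.map f).Nodup) :
    ∃ i j t, s = i ::ₘ j ::ₘ t ∧ f i = f j := by
  induction s using Multiset.induction with
  | empty => simp at h
  | cons c t ih =>
    by_cases ht : (t.map f).Nodup
    · rw [Multiset.map_cons, Multiset.nodup_cons] at h
      have : f c ∈ t.map f := by tauto
      obtain ⟨j, hj, hfj⟩ := Multiset.mem_map.1 this
      obtain ⟨u, rfl⟩ := Multiset.exists_cons_of_mem hj
      exact ⟨c, j, u, rfl, hfj.symm⟩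
    · obtain ⟨i, j, u, rfl, hf⟩ := ih ht
      refine ⟨i, j, c ::ₘ u, ?_, hf⟩
      rw [Multiset.cons_swap c i, Multiset.cons_swap c j]

lemma hp_decomp {n : ℕ} (S : Multiset (QuaternionGroup n)) :
    ∃ cs ds : Multiset (ZMod (2 * n)), S = cs.map a + ds.map xa := by
  induction S using Multiset.induction with
  | empty => exact ⟨0, 0, by simp⟩
  | cons g t ih =>
    obtain ⟨cs, ds, rfl⟩ := ih
    cases g with
    | a i => exact ⟨i ::ₘ cs, ds, by simp⟩
    | xa i => exact ⟨cs, i ::ₘ ds, by simp⟩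

lemma hp_list_a {n : ℕ} (l : List (ZMod (2 * n))) :
    (l.map (a : _ → QuaternionGroup n)).prod = a l.sum := by
  induction l with
  | nil => rfl
  | cons c t ih => simp [ih]

lemma hp_nn {n : ℕ} : (n : ZMod (2 * n)) + n = 0 := by
  have := ZMod.natCast_self (2 * n)
  push_cast at this
  rw [← this]; ring

lemma hp_ker {n : ℕ} [NeZero n] (z : ZMod (2 * n))
    (h : ZMod.castHom (Dvd.intro_left 2 rfl : n ∣ 2 * n) (ZMod n) z = 0) : z = 0 ∨ z = n := by
  have hz : ((z.val : ℕ) : ZMod (2 * n)) = z := ZMod.natCast_zmod_val z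
  rw [← hz, map_natCast, ZMod.natCast_eq_zero_iff] at h
  obtain ⟨k, hk⟩ := h
  have hlt := ZMod.val_lt z
  have hn : 0 < n := Nat.pos_of_ne_zero (NeZero.ne n)
  have : k < 2 := by
    by_contra! h2
    have : n * 2 ≤ n * k := Nat.mul_le_mul_left _ h2
    omega
  rw [← hz, hk]
  interval_cases k <;> simp

section iso
variable (n : ℕ)

local notation "MM" => Metacyclic 4 n (-1)

lemma hp_x4 : (mcX 4 n (-1)) ^ 4 = 1 := by
  have : PresentedGroup.mk (metacyclicRels 4 n (-1)) (FreeGroup.of 0 ^ 4) = 1 :=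
    (PresentedGroup.one_of_mem (by simp [metacyclicRels]))
  rw [map_pow] at this
  exact this

lemma hp_yn : (mcY 4 n (-1)) ^ n = 1 := by
  have : PresentedGroup.mk (metacyclicRels 4 n (-1)) (FreeGroup.of 1 ^ n) = 1 :=
    (PresentedGroup.one_of_mem (by simp [metacyclicRels]))
  rw [map_pow] at this
  exact this

lemma hp_yx : mcY 4 n (-1) * mcX 4 n (-1) = mcX 4 n (-1) * (mcY 4 n (-1))⁻¹ := by
  have : PresentedGroup.mk (metacyclicRels 4 n (-1)) (FreeGroup.of 1 * FreeGroup.of 0 *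
      (FreeGroup.of 0 * FreeGroup.of 1 ^ (-1 : ℤ))⁻¹) = 1 :=
    (PresentedGroup.one_of_mem (by simp [metacyclicRels]))
  rw [map_mul, map_inv, mul_inv_eq_one, map_mul, map_mul, zpow_neg_one, map_inv] at this
  exact this

/-- the hom to the quaternion group -/
def hpToQ : MM →* QuaternionGroup n :=
  PresentedGroup.toGroup (f := ![xa 0, a 2]) (by
    intro r hr
    simp only [metacyclicRels, Set.mem_insert_iff, Set.mem_singleton_iff] at hr
    have h2 : ∀ k : ℕ, (a 2 : QuaternionGroup n) ^ k = a (2 * k) := by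
      intro k
      induction k with
      | zero => simp
      | succ k ih => rw [pow_succ, ih, a_mul_a]; push_cast; ring_nf
    rcases hr with rfl | rfl | rfl
    · simp
    · have := ZMod.natCast_self (2 * n)
      push_cast at this
      simp [h2, this]
    · rw [map_mul, map_inv, mul_inv_eq_one]
      simp
      rw [eq_mul_inv_iff_mul_eq]
      simp)

@[simp] lemma hpToQ_x : hpToQ n (mcX 4 n (-1)) = xa 0 := by
  simp [hpToQ, mcX]

@[simp] lemma hpToQ_y : hpToQ n (mcY 4 n (-1)) = a 2 := by
  simp [hpToQ, mcY]

/-- element of order 2n -/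
def hpA : MM := mcX 4 n (-1) ^ 2 * mcY 4 n (-1) ^ ((n + 1) / 2)

lemma hp_comm : Commute (mcX 4 n (-1) ^ 2) (mcY 4 n (-1)) := by
  have h : SemiconjBy (mcX 4 n (-1)) (mcY 4 n (-1))⁻¹ (mcY 4 n (-1)) := (hp_yx n).symm
  have h' := h.inv_right
  rw [inv_inv] at h'
  rw [sq]
  exact SemiconjBy.mul_left h h'

lemma hp_A2 (hodd : Odd n) : hpA n ^ 2 = mcY 4 n (-1) := by
  obtain ⟨k, hk⟩ := hodd
  have h1 : (n + 1) / 2 * 2 = n + 1 := by omega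
  rw [hpA, ((hp_comm n).pow_right _).mul_pow, ← pow_mul, ← pow_mul, h1, pow_succ _ n, hp_yn,
    one_mul, hp_x4, one_mul]

lemma hp_An (hodd : Odd n) : hpA n ^ n = mcX 4 n (-1) ^ 2 := by
  obtain ⟨k, hk⟩ := hodd
  rw [hpA, ((hp_comm n).pow_right _).mul_pow, ← pow_mul, ← pow_mul, mul_comm ((n + 1) / 2) n, pow_mul _ n ((n + 1) / 2),
    hp_yn, one_pow, mul_one]
  have : 2 * n = 4 * k + 2 := by omega
  rw [this, pow_add, pow_mul, hp_x4, one_pow, one_mul]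

lemma hp_A2n (hodd : Odd n) : hpA n ^ (2 * n) = 1 := by
  rw [mul_comm, pow_mul, hp_An n hodd, ← pow_mul, hp_x4]

lemma hp_Ax : SemiconjBy (mcX 4 n (-1)) (hpA n)⁻¹ (hpA n) := by
  have h : SemiconjBy (mcX 4 n (-1)) (mcY 4 n (-1))⁻¹ (mcY 4 n (-1)) := (hp_yx n).symm
  have hx : (mcX 4 n (-1) ^ 2)⁻¹ = mcX 4 n (-1) ^ 2 := by
    rw [inv_eq_iff_mul_eq_one, ← pow_add]; exact hp_x4 n
  have h1 : (hpA n)⁻¹ = mcX 4 n (-1) ^ 2 * ((mcY 4 n (-1))⁻¹) ^ ((n + 1) / 2) := by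
    rw [hpA, mul_inv_rev, hx, inv_pow, ← inv_pow]
    exact (((hp_comm n).inv_right).pow_right _).symm
  rw [h1, hpA]
  exact SemiconjBy.mul_right ((Commute.refl _).pow_right 2) (h.pow_right _)

/-- powers of A -/
def hpPhi (hodd : Odd n) : ZMod (2 * n) →+ Additive MM :=
  ZMod.lift (2 * n) ⟨zmultiplesHom (Additive MM) (Additive.ofMul (hpA n)), by
    have := hp_A2n n hodd
    simp only [zmultiplesHom_apply]
    rw [natCast_zsmul, ← ofMul_pow, this]; rfl⟩

lemma hpPhi_nat (hodd : Odd n) (k : ℕ) :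
    (hpPhi n hodd (k : ZMod (2 * n))).toMul = hpA n ^ k := by
  have : hpPhi n hodd ((k : ℤ) : ZMod (2 * n)) = (k : ℤ) • (Additive.ofMul (hpA n)) := by
    rw [hpPhi, ZMod.lift_coe]; rfl
  rw [Int.cast_natCast] at this
  rw [this]
  simp

lemma hpPhi_x [NeZero n] (hodd : Odd n) (i : ZMod (2 * n)) :
    (hpPhi n hodd i).toMul * mcX 4 n (-1) = mcX 4 n (-1) * (hpPhi n hodd (-i)).toMul := by
  rw [map_neg, toMul_neg, ← ZMod.natCast_zmod_val i, hpPhi_nat, ← inv_pow]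
  exact ((hp_Ax n).pow_right _).symm

/-- function underlying inverse -/
def hpInvFun (hodd : Odd n) : QuaternionGroup n → MM
  | a i => (hpPhi n hodd i).toMul
  | xa i => mcX 4 n (-1) * (hpPhi n hodd i).toMul

/-- inverse hom -/
def hpInv [NeZero n] (hodd : Odd n) : QuaternionGroup n →* MM :=
  MonoidHom.mk' (hpInvFun n hodd) (by
    rintro (i | i) (j | j)
    · simp [hpInvFun]
    · simp only [a_mul_xa, hpInvFun]
      rw [← mul_assoc, hpPhi_x, mul_assoc, ← toMul_add, ← map_add]
      congr 3; abel_nf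
    · simp [hpInvFun, mul_assoc]
    · simp only [xa_mul_xa, hpInvFun]
      rw [mul_assoc, ← mul_assoc _ (mcX _ _ _), hpPhi_x, mul_assoc, ← toMul_add, ← map_add,
        ← mul_assoc, ← sq, ← hp_An n hodd, ← hpPhi_nat n hodd, ← toMul_add, ← map_add]
      congr 2; abel_nf)

lemma hp_left [NeZero n] (hodd : Odd n) (g : MM) : hpInv n hodd (hpToQ n g) = g := by
  have : (hpInv n hodd).comp (hpToQ n) = MonoidHom.id _ := by
    apply PresentedGroup.ext
    intro i
    fin_cases i
    · have h := hpToQ_x n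
      change hpInv n hodd (hpToQ n (mcX 4 n (-1))) = mcX 4 n (-1)
      rw [h]
      change mcX 4 n (-1) * (hpPhi n hodd 0).toMul = _
      simp
    · have h := hpToQ_y n
      change hpInv n hodd (hpToQ n (mcY 4 n (-1))) = mcY 4 n (-1)
      rw [h]
      change (hpPhi n hodd 2).toMul = _
      rw [← hp_A2 n hodd, ← hpPhi_nat n hodd]
      rfl
  exact DFunLike.congr_fun this g

lemma hpToQ_A (hodd : Odd n) : hpToQ n (hpA n) = a 1 := by
  have h2 : ∀ k : ℕ, (a 2 : QuaternionGroup n) ^ k = a (2 * k) := by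
    intro k
    induction k with
    | zero => simp
    | succ k ih => rw [pow_succ, ih, a_mul_a]; push_cast; ring_nf
  rw [hpA, map_mul, map_pow, map_pow, hpToQ_x, hpToQ_y, xa_sq, h2, a_mul_a]
  congr 1
  obtain ⟨k, hk⟩ := hodd
  have : n + 2 * ((n + 1) / 2) = 2 * n + 1 := by omega
  have h3 := congrArg (Nat.cast : ℕ → ZMod (2 * n)) this
  have h4 := hp_nn (n := n)
  rw [← two_mul] at h4
  push_cast at h3
  rw [h4, zero_add] at h3
  exact h3

lemma hp_right [NeZero n] (hodd : Odd n) (g : QuaternionGroup n) :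
    hpToQ n (hpInv n hodd g) = g := by
  have key : ∀ i, hpToQ n (hpPhi n hodd i).toMul = a i := by
    intro i
    rw [← ZMod.natCast_zmod_val i, hpPhi_nat, map_pow, hpToQ_A n hodd, a_one_pow]
  cases g with
  | a i => exact key i
  | xa i =>
    change hpToQ n (mcX 4 n (-1) * (hpPhi n hodd i).toMul) = _
    rw [map_mul, key, hpToQ_x]
    simp

/-- the isomorphism -/
def hpEquiv [NeZero n] (hodd : Odd n) : MM ≃* QuaternionGroup n where
  toFun := hpToQ n
  invFun := hpInv n hodd
  left_inv := hp_left n hodd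
  right_inv := hp_right n hodd
  map_mul' := map_mul _

end iso

lemma hp_lower (n : ℕ) (hn : 3 ≤ n) :
    ProductOneFree (xa 0 ::ₘ Multiset.replicate (2 * n - 1) (a 1 : QuaternionGroup n)) := by
  have : NeZero n := ⟨by omega⟩
  rintro T hT hT0 ⟨l, hl, hp⟩
  -- every list of a 1 has product a power
  have hrep : ∀ T' : Multiset (QuaternionGroup n),
      T' ≤ Multiset.replicate (2 * n - 1) (a 1 : QuaternionGroup n) →
      ∃ k ≤ 2 * n - 1, T' = Multiset.replicate k (a 1) := by
    intro T' h
    obtain ⟨k, hk, h⟩ := Multiset.le_replicate_iff.1 h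
    exact ⟨k, hk, h⟩
  by_cases hx : (xa 0 : QuaternionGroup n) ∈ T
  · obtain ⟨T', rfl⟩ := Multiset.exists_cons_of_mem hx
    obtain ⟨k, hk, rfl⟩ := hrep T' ((Multiset.cons_le_cons_iff _).1 hT)
    have hxl : (xa 0 : QuaternionGroup n) ∈ l := by
      rw [← Multiset.mem_coe, hl]; simp
    obtain ⟨l₁, l₂, rfl⟩ := List.append_of_mem hxl
    have hl' : ((l₁ ++ l₂ : List _) : Multiset (QuaternionGroup n)) = Multiset.replicate k (a 1) := by
      have : ((l₁ ++ xa 0 :: l₂ : List _) : Multiset (QuaternionGroup n)) =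
        xa 0 ::ₘ ((l₁ ++ l₂ : List _) : Multiset (QuaternionGroup n)) := by
        rw [Multiset.cons_coe, Multiset.coe_eq_coe]
        exact List.perm_middle
      rw [this] at hl
      exact (Multiset.cons_inj_right _).1 hl
    have hmem : ∀ b ∈ l₁ ++ l₂, b = a 1 := by
      intro b hb
      rw [← Multiset.mem_coe, hl'] at hb
      exact Multiset.eq_of_mem_replicate hb
    have h1 : l₁ = List.replicate l₁.length (a 1) :=
      List.eq_replicate_of_mem (fun b hb => hmem b (by simp [hb]))
    have h2 : l₂ = List.replicate l₂.length (a 1) :=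
      List.eq_replicate_of_mem (fun b hb => hmem b (by simp [hb]))
    rw [h1, h2, List.prod_append, List.prod_cons, List.prod_replicate, List.prod_replicate,
      a_one_pow, a_one_pow, xa_mul_a, a_mul_xa, one_def] at hp
    cases hp
  · obtain ⟨k, hk, rfl⟩ := hrep T ((Multiset.le_cons_of_notMem hx).1 hT)
    have h1 : l = List.replicate k (a 1) := by
      rw [← Multiset.coe_replicate, Multiset.coe_eq_coe] at hl
      exact List.perm_replicate.1 hl
    rw [h1, List.prod_replicate] at hp
    have h2 := orderOf_dvd_of_pow_eq_one hp
    rw [orderOf_a_one] at h2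
    have hk0 : k ≠ 0 := by rintro rfl; simp at hT0
    have := Nat.le_of_dvd (by omega) h2
    omega

lemma hp_mk_le {n : ℕ} {cs ds cs' ds' : Multiset (ZMod (2 * n))} (h1 : cs' ≤ cs) (h2 : ds' ≤ ds) :
    cs'.map a + ds'.map xa ≤ (cs.map a + ds.map xa : Multiset (QuaternionGroup n)) :=
  add_le_add (Multiset.map_le_map h1) (Multiset.map_le_map h2)

/-- case of many rotations -/
lemma hp_case1 {n : ℕ} [NeZero n] (cs ds : Multiset (ZMod (2 * n)))
    (hf : ProductOneFree (cs.map a + ds.map xa : Multiset (QuaternionGroup n)))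
    (hk : n ≤ Multiset.card cs) (hl : 2 * n + 1 ≤ Multiset.card cs + Multiset.card ds) : False := by
  have hz : ∀ T ≤ cs, T ≠ 0 → T.sum ≠ 0 := by
    intro T hT hT0 hs
    have := hp_mk_le hT (Multiset.zero_le ds)
    simp only [Multiset.map_zero, add_zero] at this
    refine hf _ this (by simpa using hT0) ⟨T.toList.map a, ?_, ?_⟩
    · rw [← Multiset.map_coe, Multiset.coe_toList]
    · rw [hp_list_a, Multiset.sum_toList, hs, a_zero]
  by_cases hd : 2 ≤ Multiset.card ds
  · obtain ⟨i, hi⟩ := Multiset.card_pos_iff_exists_mem.1 (by omega : 0 < Multiset.card ds)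
    obtain ⟨ds1, rfl⟩ := Multiset.exists_cons_of_mem hi
    rw [Multiset.card_cons] at hd
    obtain ⟨j, hj⟩ := Multiset.card_pos_iff_exists_mem.1 (by omega : 0 < Multiset.card ds1)
    obtain ⟨ds2, rfl⟩ := Multiset.exists_cons_of_mem hj
    obtain ⟨T₁, T₂, hT, hs⟩ := hp_diff cs hz (by rw [ZMod.card]; omega) (n + j - i)
    refine hf ((T₁ + T₂).map a + Multiset.map xa {i, j}) (hp_mk_le hT ?_) (by simp)
      ⟨xa i :: (T₁.toList.map a ++ xa j :: T₂.toList.map a), ?_, ?_⟩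
    · exact (Multiset.cons_le_cons_iff _).2 ((Multiset.cons_le_cons_iff _).2 (Multiset.zero_le _))
    · rw [← Multiset.cons_coe, ← Multiset.coe_add, ← Multiset.cons_coe, ← Multiset.map_coe,
        ← Multiset.map_coe, Multiset.coe_toList, Multiset.coe_toList]
      simp
      rw [← Multiset.singleton_add]
      abel
    · simp only [List.prod_cons, List.prod_append, hp_list_a, Multiset.sum_toList]
      simp only [a_mul_xa, xa_mul_a, xa_mul_xa, a_mul_a, one_def]
      congr 1
      linear_combination -hs
  · have := hp_sums cs hz
    have h2 := Finset.card_le_univ (cs.powerset.map Multiset.sum).toFinset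
    rw [ZMod.card] at h2
    omega

/-- case of many non-rotations -/
lemma hp_case2 {n : ℕ} (hn : 3 ≤ n) (hodd : Odd n) (cs ds : Multiset (ZMod (2 * n)))
    (hf : ProductOneFree (cs.map a + ds.map xa : Multiset (QuaternionGroup n)))
    (hk : n + 2 ≤ Multiset.card ds) (hl : 2 * n + 1 ≤ Multiset.card cs + Multiset.card ds) :
    False := by
  have : NeZero n := ⟨by omega⟩
  have key : ∀ l : List (QuaternionGroup n), ∀ cs' ≤ cs, ∀ ds' ≤ ds, l ≠ [] →
      (l : Multiset _) = cs'.map a + ds'.map xa → l.prod ≠ 1 := by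
    intro l cs' h1 ds' h2 h0 h3 hp
    refine hf (l : Multiset _) ?_ (by simpa using h0) ⟨l, rfl, hp⟩
    rw [h3]; exact hp_mk_le h1 h2
  have hnn := hp_nn (n := n)
  set f := ZMod.castHom (Dvd.intro_left 2 rfl : n ∣ 2 * n) (ZMod n) with hfdef
  have hker : ∀ i j : ZMod (2 * n), f i = f j → i = j ∨ i = j + n := by
    intro i j hij
    rcases hp_ker (i - j) (by rw [map_sub, ← hfdef, hij, sub_self]) with h | h
    · left; exact sub_eq_zero.1 h
    · right; rw [← h]; abel
  have hnd : ∀ s : Multiset (ZMod (2 * n)), (s.map f).Nodup → Multiset.card s ≤ n := by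
    intro s hs
    have := Multiset.card_le_card (Multiset.le_iff_subset hs |>.2
      (fun x _ => Finset.mem_univ x : s.map f ⊆ (Finset.univ : Finset (ZMod n)).val))
    simpa using this
  have hpairne : ∀ i j, i ::ₘ {j} ≤ ds → i ≠ j + n := by
    rintro i j h rfl
    refine key [xa (j + n), xa j] 0 (Multiset.zero_le _) _ h (by simp) rfl ?_
    simp only [List.prod_cons, List.prod_nil, one_def, a_mul_a, a_mul_xa, xa_mul_a, xa_mul_xa]
    congr 1
    ring
  obtain ⟨i, u, t, rfl, hiu⟩ := hp_pair f ds (fun h => by have := hnd _ h; omega)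
  have hle : ∀ s ≤ t, i ::ₘ u ::ₘ s ≤ i ::ₘ u ::ₘ t := fun s hs =>
    (Multiset.cons_le_cons_iff _).2 ((Multiset.cons_le_cons_iff _).2 hs)
  have hle0 : ∀ s ≤ t, s ≤ i ::ₘ u ::ₘ t := fun s hs =>
    hs.trans ((Multiset.le_cons_self _ _).trans (Multiset.le_cons_self _ _))
  have hle1 : ∀ s ≤ t, u ::ₘ s ≤ i ::ₘ u ::ₘ t := fun s hs =>
    ((Multiset.cons_le_cons_iff _).2 hs).trans (Multiset.le_cons_self _ _)
  have : i = u := by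
    rcases hker _ _ hiu with h | h
    · exact h
    · exact absurd h (hpairne _ _ (hle 0 (Multiset.zero_le _)))
  subst this
  have htnd : (t.map f).Nodup := by
    by_contra hcon
    obtain ⟨p, q, t', rfl, hpq⟩ := hp_pair f t hcon
    have hpq' : p ::ₘ {q} ≤ p ::ₘ q ::ₘ t' :=
      (Multiset.cons_le_cons_iff _).2 ((Multiset.cons_le_cons_iff _).2 (Multiset.zero_le _))
    have : p = q := by
      rcases hker _ _ hpq with h | h
      · exact h
      · exact absurd h (hpairne _ _ (hle0 _ hpq'))
    subst this
    refine key [xa i, xa i, xa p, xa p] 0 (Multiset.zero_le _) _ (hle _ hpq') (by simp)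
      rfl ?_
    simp only [List.prod_cons, List.prod_nil, one_def, a_mul_a, a_mul_xa, xa_mul_a, xa_mul_xa]
    congr 1
    linear_combination 2 * hnn - hnn
  have htc := hnd t htnd
  simp only [Multiset.card_cons] at hk hl
  have hall : ∀ r : ZMod n, ∃ d ∈ t, f d = r := by
    intro r
    have h1 : t.map f = (Finset.univ : Finset (ZMod n)).val := by
      apply Multiset.eq_of_le_of_card_le (Multiset.le_iff_subset htnd |>.2
        (fun x _ => Finset.mem_univ x))
      simp; omega
    have : r ∈ t.map f := by rw [h1]; exact Finset.mem_univ r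
    simpa using this
  obtain ⟨c, hc⟩ := Multiset.card_pos_iff_exists_mem.1 (by omega : 0 < Multiset.card cs)
  have hc1 : ({c} : Multiset _) ≤ cs := by simpa using hc
  have hc0 : f c ≠ 0 := by
    intro h0
    rcases hp_ker c h0 with rfl | rfl
    · exact key [a 0] {0} hc1 0 (Multiset.zero_le _) (by simp) (by simp) (by simp)
    · refine key [a n, xa i, xa i] {(n : ZMod (2 * n))} hc1 _ (hle 0 (Multiset.zero_le _))
        (by simp) rfl ?_
      simp only [List.prod_cons, List.prod_nil, one_def, a_mul_a, a_mul_xa, xa_mul_a, xa_mul_xa]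
      congr 1
      linear_combination hnn
  obtain ⟨v, hv, hfv⟩ := hall (f i + f c)
  obtain ⟨w, hw, hfw⟩ := hall (f i - f c)
  have hvw : v ≠ w := by
    rintro rfl
    have h2 : (2 : ZMod n) * f c = 0 := by
      have : f i + f c = f i - f c := hfv.symm.trans hfw
      linear_combination this
    have hu : IsUnit (2 : ZMod n) := by
      have := (ZMod.isUnit_iff_coprime 2 n).2 (Nat.coprime_two_left.2 hodd)
      simpa using this
    exact hc0 ((hu.mul_right_eq_zero).1 h2)
  have hvt : ({v} : Multiset _) ≤ t := by simpa using hv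
  have hwt : ({w} : Multiset _) ≤ t := by simpa using hw
  have hvwt : v ::ₘ {w} ≤ t := by
    obtain ⟨t', rfl⟩ := Multiset.exists_cons_of_mem hv
    refine (Multiset.cons_le_cons_iff _).2 ?_
    rw [Multiset.singleton_le]
    rcases Multiset.mem_cons.1 hw with h | h
    · exact absurd h.symm hvw
    · exact h
  rcases hker v (i + c) (by rw [hfv, map_add]) with h1 | h1
  · rcases hker w (i - c) (by rw [hfw, map_sub]) with h2 | h2
    · refine key [xa i, xa v, xa i, xa w] 0 (Multiset.zero_le _) _ (hle _ hvwt) (by simp) ?_ ?_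
      · change (([xa i, xa v, xa i, xa w] : List _) : Multiset (QuaternionGroup n)) =
          (([xa i, xa i, xa v, xa w] : List _) : Multiset (QuaternionGroup n))
        exact Multiset.coe_eq_coe.2 ((List.Perm.swap _ _ _).cons _)
      · subst h1 h2
        simp only [List.prod_cons, List.prod_nil, one_def, a_mul_a, a_mul_xa, xa_mul_a, xa_mul_xa]
        congr 1
        linear_combination hnn
    · refine key [a c, xa i, xa w] {c} hc1 _ (hle1 _ hwt) (by simp) rfl ?_
      subst h2
      simp only [List.prod_cons, List.prod_nil, one_def, a_mul_a, a_mul_xa, xa_mul_a, xa_mul_xa]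
      congr 1
      linear_combination hnn
  · refine key [xa i, a c, xa v] {c} hc1 _ (hle1 _ hvt) (by simp) ?_ ?_
    · change (([xa i, a c, xa v] : List _) : Multiset (QuaternionGroup n)) =
          (([a c, xa i, xa v] : List _) : Multiset (QuaternionGroup n))
      exact Multiset.coe_eq_coe.2 (List.Perm.swap _ _ _)
    · subst h1
      simp only [List.prod_cons, List.prod_nil, one_def, a_mul_a, a_mul_xa, xa_mul_a, xa_mul_xa]
      congr 1
      linear_combination hnn

lemma hp_davenport (n : ℕ) (hn : 3 ≤ n) (hodd : Odd n) :
    smallDavenport (QuaternionGroup n) = 2 * n := by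
  have : NeZero n := ⟨by omega⟩
  refine IsGreatest.csSup_eq ⟨⟨_, ?_, hp_lower n hn⟩, ?_⟩
  · simp; omega
  · rintro k ⟨S, rfl, hf⟩
    by_contra! hlt
    obtain ⟨cs, ds, rfl⟩ := hp_decomp S
    simp only [Multiset.card_add, Multiset.card_map] at hlt
    by_cases h : n ≤ Multiset.card cs
    · exact hp_case1 cs ds hf h (by omega)
    · exact hp_case2 hn hodd cs ds hf (by omega) (by omega)

end helpers

/-- For odd `n ≥ 3`, `d(G_{4,n,-1}) = 2n` and `E(G_{4,n,-1}) ≥ 6n`; in particular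
`d(G_{4,n,-1}) > 4 + n - 2`, so `G_{4,n,-1}` fails the conclusion of Bass' conjecture. -/
theorem bass_fails_dicyclic (n : ℕ) (hn : 3 ≤ n) (hodd : Odd n) :
    smallDavenport (Metacyclic 4 n (-1)) = 2 * n ∧
    6 * n ≤ gaoConstant (Metacyclic 4 n (-1)) ∧
    4 + n - 2 < smallDavenport (Metacyclic 4 n (-1)) ∧
    ¬ (smallDavenport (Metacyclic 4 n (-1)) = 4 + n - 2 ∧
       gaoConstant (Metacyclic 4 n (-1)) = 4 * n + 4 + n - 2) := by
  have : NeZero n := ⟨by omega⟩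
  have e := hpEquiv n hodd
  have hd : smallDavenport (Metacyclic 4 n (-1)) = 2 * n := by
    rw [hp_davenport_congr e, hp_davenport n hn hodd]
  have hfin : Finite (Metacyclic 4 n (-1)) := Finite.of_equiv _ e.symm.toEquiv
  have hcard : Nat.card (Metacyclic 4 n (-1)) = 4 * n := by
    rw [Nat.card_congr e.toEquiv, Nat.card_eq_fintype_card, QuaternionGroup.card]
  have hg := hp_gao_ge (hp_free_map e.symm (hp_lower n hn))
  rw [hcard, Multiset.card_map, Multiset.card_cons, Multiset.card_replicate] at hg
  refine ⟨hd, by omega, by omega, by omega⟩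
end

section
/- Let m = 2m₀ and n = 2n₀ be even positive integers and let s be an odd integer with s^m ≡ 1 (mod n), and let G_{m,n,s} = ⟨x, y | x^m = y^n = 1, yx = xy^s⟩. Then H = ⟨x², y²⟩ is a normal subgroup of G_{m,n,s} isomorphic to the metacyclic group C_{n₀} ⋊_{s²} C_{m₀} = G_{m₀,n₀,s²}, and the quotient G_{m,n,s}/H is isomorphic to C₂ × C₂. -/
namespace MCaux

theorem exists_lift {G : Type*} [Group G] (m n : ℕ) (s : ℤ) (a b : G)
    (ha : a ^ m = 1) (hb : b ^ n = 1) (hc : b * a = a * b ^ s) :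
    ∃ f : Metacyclic m n s →* G, f (mcX m n s) = a ∧ f (mcY m n s) = b := by
  have h : ∀ r ∈ metacyclicRels m n s, FreeGroup.lift (![a, b] : Fin 2 → G) r = 1 := by
    rintro r (rfl | rfl | rfl)
    · simp [ha]
    · simp [hb]
    · simp [hc]
  refine ⟨PresentedGroup.toGroup h, ?_, ?_⟩
  · exact PresentedGroup.toGroup.of h
  · exact PresentedGroup.toGroup.of h

theorem x_pow (m n : ℕ) (s : ℤ) : mcX m n s ^ m = 1 := by
  have : PresentedGroup.mk (metacyclicRels m n s) (FreeGroup.of 0 ^ m) = 1 :=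
    PresentedGroup.one_of_mem (by simp [metacyclicRels])
  simp only [map_mul, map_pow, map_zpow] at this
  exact this

theorem y_pow (m n : ℕ) (s : ℤ) : mcY m n s ^ n = 1 := by
  have : PresentedGroup.mk (metacyclicRels m n s) (FreeGroup.of 1 ^ n) = 1 :=
    PresentedGroup.one_of_mem (by simp [metacyclicRels])
  simp only [map_mul, map_pow, map_zpow] at this
  exact this

theorem y_x (m n : ℕ) (s : ℤ) : mcY m n s * mcX m n s = mcX m n s * mcY m n s ^ s := by
  have : PresentedGroup.mk (metacyclicRels m n s)
    (FreeGroup.of 1 * FreeGroup.of 0 * (FreeGroup.of 0 * FreeGroup.of 1 ^ s)⁻¹) = 1 :=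
    PresentedGroup.one_of_mem (by simp [metacyclicRels])
  rw [map_mul, map_inv, mul_inv_eq_one] at this
  simp only [map_mul, map_pow, map_zpow] at this
  exact this

theorem comm1 {G : Type*} [Group G] {x y : G} {s : ℤ} (h : y * x = x * y ^ s) (k : ℤ) :
    y ^ k * x = x * y ^ (s * k) := by
  have h1 : SemiconjBy x (y ^ s) y := h.symm
  have := h1.zpow_right k
  rw [zpow_mul]
  exact this.symm

theorem comm2 {G : Type*} [Group G] {x y : G} {s : ℤ} (h : y * x = x * y ^ s) (a : ℕ) (k : ℤ) :
    y ^ k * x ^ a = x ^ a * y ^ (s ^ a * k) := by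
  induction a generalizing k with
  | zero => simp
  | succ a ih =>
    rw [pow_succ, ← mul_assoc, ih, mul_assoc, comm1 h, ← mul_assoc]
    congr 2
    ring

theorem gen (m n : ℕ) (s : ℤ) : Subgroup.closure {mcX m n s, mcY m n s} = ⊤ := by
  rw [← PresentedGroup.closure_range_of]
  congr 1
  ext g
  simp only [Set.mem_insert_iff, Set.mem_singleton_iff, Set.mem_range, Fin.exists_fin_two]
  constructor
  · rintro (rfl | rfl)
    · exact Or.inl rfl
    · exact Or.inr rfl
  · rintro (rfl | rfl)
    · exact Or.inl rfl
    · exact Or.inr rfl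

theorem normal_form (m n : ℕ) (hm : 0 < m) (s : ℤ) (g : Metacyclic m n s) :
    ∃ (a : ℕ) (b : ℤ), g = mcX m n s ^ a * mcY m n s ^ b := by
  have hg : g ∈ Subgroup.closure {mcX m n s, mcY m n s} := by rw [gen]; trivial
  have hx : (mcX m n s)⁻¹ = mcX m n s ^ (m - 1) := by
    rw [inv_eq_iff_mul_eq_one, ← pow_succ', Nat.sub_add_cancel hm, x_pow]
  have key := comm2 (y_x m n s)
  induction hg using Subgroup.closure_induction_left with
  | one => exact ⟨0, 0, by simp⟩
  | mul_left u hu v _ ih =>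
    obtain ⟨a, b, rfl⟩ := ih
    rcases hu with rfl | rfl
    · exact ⟨a + 1, b, by rw [pow_succ', mul_assoc]⟩
    · refine ⟨a, s ^ a * 1 + b, ?_⟩
      rw [zpow_add, ← mul_assoc, ← mul_assoc, ← key, zpow_one]
  | inv_mul_cancel u hu v _ ih =>
    obtain ⟨a, b, rfl⟩ := ih
    rcases hu with rfl | rfl
    · exact ⟨m - 1 + a, b, by rw [hx, pow_add, mul_assoc]⟩
    · refine ⟨a, s ^ a * (-1) + b, ?_⟩
      rw [zpow_add, ← mul_assoc, ← mul_assoc, ← key, zpow_neg_one]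

theorem faithful (m n : ℕ) (hm : 0 < m) (s : ℤ) (hs : (s : ZMod n) ^ m = 1) (a : ℕ) (b : ℤ)
    (h : mcX m n s ^ a * mcY m n s ^ b = 1) : m ∣ a ∧ (n : ℤ) ∣ b := by
  have hma : m ∣ a := by
    obtain ⟨f, hfx, hfy⟩ := exists_lift m n s (Multiplicative.ofAdd (1 : ZMod m)) 1
      (by rw [← ofAdd_nsmul]; simp) (by simp) (by simp)
    have := congrArg f h
    rw [map_mul, map_pow, map_zpow, hfx, hfy, one_zpow, mul_one, map_one f, ← ofAdd_nsmul,
      ofAdd_eq_one] at this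
    rw [← ZMod.natCast_eq_zero_iff]
    simpa using this
  refine ⟨hma, ?_⟩
  have hxa : mcX m n s ^ a = 1 := by
    obtain ⟨c, rfl⟩ := hma
    rw [pow_mul, x_pow, one_pow]
  rw [hxa, one_mul] at h
  have hinv : (s : ZMod n) * (s : ZMod n) ^ (m - 1) = 1 := by
    rw [← pow_succ', Nat.sub_add_cancel hm, hs]
  let u : (ZMod n)ˣ := ⟨(s : ZMod n), (s : ZMod n) ^ (m - 1), hinv, by rw [mul_comm, hinv]⟩
  have hu : u ^ m = 1 := by ext; simpa [u] using hs
  let A : Equiv.Perm (ZMod n) := MulAction.toPermHom (ZMod n)ˣ (ZMod n) u⁻¹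
  have hA : ∀ t, A t = ((u⁻¹ : (ZMod n)ˣ) : ZMod n) * t := fun t => rfl
  have hB : ∀ (k : ℤ) (t : ZMod n), (Equiv.addRight (1 : ZMod n) ^ k : Equiv.Perm (ZMod n)) t = t + k := by
    intro k t
    induction k using Int.induction_on generalizing t with
    | zero => simp
    | succ k ih => rw [zpow_add_one, Equiv.Perm.mul_apply, ih]; simp; ring
    | pred k ih => rw [zpow_sub_one, Equiv.Perm.mul_apply, ih, Equiv.Perm.inv_def]; simp; ring
  obtain ⟨f, hfx, hfy⟩ := exists_lift m n s A (Equiv.addRight (1 : ZMod n))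
    (by simp only [A]; rw [← map_pow, inv_pow, hu, inv_one, map_one])
    (by ext t; rw [← zpow_natCast, hB]; simp)
    (by
      ext t
      rw [Equiv.Perm.mul_apply, Equiv.Perm.mul_apply, hB, hA, hA]
      have : ((u⁻¹ : (ZMod n)ˣ) : ZMod n) * (s : ZMod n) = 1 := u.inv_mul
      rw [mul_add, this]; rfl)
  have := congrArg f h
  rw [map_zpow, hfy, map_one] at this
  have := congrArg (fun e : Equiv.Perm (ZMod n) => e 0) this
  simp only [hB] at this
  rw [← ZMod.intCast_zmod_eq_zero_iff_dvd]
  simpa using this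

end MCaux

/-- For `m = 2m₀`, `n = 2n₀` even and `s` odd with `s^m ≡ 1 (mod n)`, the subgroup
`H = ⟨x², y²⟩` of `G_{m,n,s}` is normal, isomorphic to `G_{m₀,n₀,s²}`, and the quotient
`G_{m,n,s}/H` is isomorphic to `C₂ × C₂` (expressed via a surjective homomorphism onto
`C₂ × C₂` with kernel `H`). -/
theorem subgroup_x_sq_y_sq (m₀ n₀ : ℕ) (hm : 0 < m₀) (hn : 0 < n₀) (s : ℤ) (hodd : Odd s)
    (hs : (s : ZMod (2 * n₀)) ^ (2 * m₀) = 1) :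
    (Subgroup.closure {mcX (2 * m₀) (2 * n₀) s ^ 2, mcY (2 * m₀) (2 * n₀) s ^ 2}).Normal ∧
    Nonempty
      ((Subgroup.closure {mcX (2 * m₀) (2 * n₀) s ^ 2, mcY (2 * m₀) (2 * n₀) s ^ 2} :
          Subgroup (Metacyclic (2 * m₀) (2 * n₀) s)) ≃* Metacyclic m₀ n₀ (s ^ 2)) ∧
    ∃ φ : Metacyclic (2 * m₀) (2 * n₀) s →*
        Multiplicative (ZMod 2) × Multiplicative (ZMod 2),
      Function.Surjective φ ∧
      MonoidHom.ker φ =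
        Subgroup.closure {mcX (2 * m₀) (2 * n₀) s ^ 2, mcY (2 * m₀) (2 * n₀) s ^ 2} := by
  set x := mcX (2 * m₀) (2 * n₀) s with hx
  set y := mcY (2 * m₀) (2 * n₀) s with hy
  have hyx : y * x = x * y ^ s := MCaux.y_x _ _ _
  have hker : ∃ φ : Metacyclic (2 * m₀) (2 * n₀) s →*
        Multiplicative (ZMod 2) × Multiplicative (ZMod 2),
      Function.Surjective φ ∧ MonoidHom.ker φ = Subgroup.closure {x ^ 2, y ^ 2} := by
    let p : Multiplicative (ZMod 2) × Multiplicative (ZMod 2) := (Multiplicative.ofAdd 1, 1)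
    let q : Multiplicative (ZMod 2) × Multiplicative (ZMod 2) := (1, Multiplicative.ofAdd 1)
    have hp : p ^ 2 = 1 := by decide
    have hq : q ^ 2 = 1 := by decide
    have hq' : q ^ (2 : ℤ) = 1 := by exact_mod_cast hq
    obtain ⟨φ, hφx, hφy⟩ := MCaux.exists_lift (2 * m₀) (2 * n₀) s p q
      (by rw [pow_mul, hp, one_pow]) (by rw [pow_mul, hq, one_pow])
      (by
        obtain ⟨k, rfl⟩ := hodd
        rw [zpow_add, zpow_mul, hq', one_zpow, one_mul, zpow_one, mul_comm])
    refine ⟨φ, ?_, le_antisymm ?_ ?_⟩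
    · have hall : ∀ g : Multiplicative (ZMod 2) × Multiplicative (ZMod 2),
          g = 1 ∨ g = p ∨ g = q ∨ g = p * q := by decide
      intro g
      rcases hall g with rfl | rfl | rfl | rfl
      · exact ⟨1, map_one _⟩
      · exact ⟨_, hφx⟩
      · exact ⟨_, hφy⟩
      · exact ⟨x * y, by rw [map_mul, hφx, hφy]⟩
    · intro g hg
      obtain ⟨a, b, rfl⟩ := MCaux.normal_form (2 * m₀) (2 * n₀) (by omega) s g
      rw [MonoidHom.mem_ker, map_mul, map_pow, map_zpow, hφx, hφy] at hg
      have h1 := congrArg (MonoidHom.fst _ _) hg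
      have h2 := congrArg (MonoidHom.snd _ _) hg
      simp only [map_mul, map_pow, map_zpow, map_one, MonoidHom.coe_fst, MonoidHom.coe_snd, p, q,
        one_pow, one_zpow, mul_one, one_mul] at h1 h2
      rw [← ofAdd_nsmul, ofAdd_eq_one, nsmul_one, ZMod.natCast_eq_zero_iff] at h1
      rw [← ofAdd_zsmul, ofAdd_eq_one, zsmul_one, ZMod.intCast_zmod_eq_zero_iff_dvd] at h2
      obtain ⟨c, rfl⟩ := h1
      obtain ⟨d, rfl⟩ := h2
      rw [pow_mul, zpow_mul]
      refine mul_mem (pow_mem (Subgroup.subset_closure (by simp [hx])) _)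
        (zpow_mem (Subgroup.subset_closure ?_) _)
      right
      exact zpow_natCast y 2
    · rw [Subgroup.closure_le]
      rintro g (rfl | rfl)
      · exact (by rw [map_pow, hφx, hp] : φ (x ^ 2) = 1)
      · exact (by rw [map_pow, hφy, hq] : φ (y ^ 2) = 1)
  refine ⟨?_, ?_, hker⟩
  · obtain ⟨φ, -, h⟩ := hker
    rw [← h]
    infer_instance
  · obtain ⟨f, hfx, hfy⟩ := MCaux.exists_lift m₀ n₀ (s ^ 2) (x ^ 2) (y ^ 2)
      (by rw [← pow_mul]; exact MCaux.x_pow _ _ _) (by rw [← pow_mul]; exact MCaux.y_pow _ _ _)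
      (by
        have := MCaux.comm2 hyx 2 2
        rw [mul_comm (s ^ 2), zpow_mul] at this
        exact_mod_cast this)
    have hinj : Function.Injective f := by
      rw [injective_iff_map_eq_one]
      intro g hg
      obtain ⟨a, b, rfl⟩ := MCaux.normal_form m₀ n₀ hm (s ^ 2) g
      rw [map_mul, map_pow, map_zpow, hfx, hfy, ← pow_mul, ← zpow_natCast y 2, ← zpow_mul] at hg
      obtain ⟨h1, h2⟩ := MCaux.faithful _ _ (by omega) s hs _ _ hg
      have h1 : m₀ ∣ a := Nat.dvd_of_mul_dvd_mul_left two_pos h1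
      have h2 : (n₀ : ℤ) ∣ b := by
        push_cast at h2
        exact Int.dvd_of_mul_dvd_mul_left two_ne_zero h2
      obtain ⟨c, rfl⟩ := h1
      obtain ⟨d, rfl⟩ := h2
      rw [pow_mul, zpow_mul, zpow_natCast, MCaux.x_pow, MCaux.y_pow, one_pow, one_zpow, mul_one]
    have hr : f.range = Subgroup.closure {x ^ 2, y ^ 2} := by
      rw [MonoidHom.range_eq_map, ← MCaux.gen, MonoidHom.map_closure, Set.image_pair, hfx, hfy]
    exact ⟨((MonoidHom.ofInjective hinj).trans (MulEquiv.subgroupCongr hr)).symm⟩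
end

section
/- In the group G_{2,3,-1} = ⟨x, y | x² = y³ = 1, yx = xy^{-1}⟩ (isomorphic to the dihedral group of order 6), the sequence S consisting of five copies of the identity 1 together with x, xy, and xy² has length 8 = E(G_{2,3,-1}) − 1 and contains no product-one subsequence of length 6. -/
namespace DihedralSix
open DihedralGroup

/-- Counts `(r 0, r 1, r 2, sr 0, sr 1, sr 2)`. -/
abbrev Cnt := ℕ × ℕ × ℕ × ℕ × ℕ × ℕ

/-- A family of length-six lists with product one, together with their counts. -/
def table : List (Cnt × List (DihedralGroup 3)) :=
  [((0, 0, 0, 0, 0, 6), [sr 2, sr 2, sr 2, sr 2, sr 2, sr 2]),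
   ((0, 0, 0, 0, 4, 2), [sr 1, sr 2, sr 2, sr 1, sr 1, sr 1]),
   ((0, 0, 0, 4, 0, 2), [sr 0, sr 0, sr 2, sr 2, sr 0, sr 0]),
   ((0, 0, 2, 2, 2, 0), [sr 0, r 2, sr 1, r 2, sr 1, sr 0]),
   ((0, 0, 4, 0, 0, 2), [r 2, sr 2, r 2, r 2, sr 2, r 2]),
   ((0, 3, 1, 0, 1, 1), [r 1, r 1, sr 1, r 2, r 1, sr 2]),
   ((2, 2, 0, 2, 0, 0), [r 0, sr 0, r 1, sr 0, r 1, r 0]),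
   ((4, 0, 0, 0, 0, 2), [sr 2, r 0, sr 2, r 0, r 0, r 0]),
   ((0, 6, 0, 0, 0, 0), [r 1, r 1, r 1, r 1, r 1, r 1]),
   ((3, 0, 3, 0, 0, 0), [r 0, r 0, r 0, r 2, r 2, r 2]),
   ((1, 1, 0, 1, 3, 0), [sr 1, r 0, sr 1, sr 0, r 1, sr 1]),
   ((0, 1, 1, 1, 0, 3), [sr 0, sr 2, r 2, sr 2, r 1, sr 2]),
   ((0, 0, 0, 6, 0, 0), [sr 0, sr 0, sr 0, sr 0, sr 0, sr 0]),
   ((0, 0, 0, 0, 6, 0), [sr 1, sr 1, sr 1, sr 1, sr 1, sr 1]),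
   ((0, 0, 6, 0, 0, 0), [r 2, r 2, r 2, r 2, r 2, r 2]),
   ((6, 0, 0, 0, 0, 0), [r 0, r 0, r 0, r 0, r 0, r 0]),
   ((0, 3, 3, 0, 0, 0), [r 2, r 1, r 1, r 2, r 1, r 2]),
   ((1, 0, 1, 3, 0, 1), [sr 2, sr 0, r 2, sr 0, sr 0, r 0]),
   ((2, 1, 1, 0, 2, 0), [sr 1, r 1, r 0, r 2, sr 1, r 0]),
   ((1, 3, 0, 0, 0, 2), [r 1, r 1, r 1, r 0, sr 2, sr 2]),
   ((0, 2, 0, 3, 1, 0), [r 1, sr 0, sr 1, sr 0, sr 0, r 1]),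
   ((0, 0, 0, 0, 2, 4), [sr 2, sr 1, sr 2, sr 2, sr 1, sr 2]),
   ((2, 0, 0, 1, 1, 2), [sr 0, r 0, sr 2, r 0, sr 1, sr 2]),
   ((0, 1, 3, 0, 1, 1), [r 2, r 1, sr 2, sr 1, r 2, r 2]),
   ((0, 4, 0, 0, 2, 0), [r 1, r 1, sr 1, r 1, r 1, sr 1]),
   ((3, 3, 0, 0, 0, 0), [r 1, r 1, r 1, r 0, r 0, r 0]),
   ((4, 0, 0, 2, 0, 0), [sr 0, r 0, sr 0, r 0, r 0, r 0]),
   ((0, 0, 2, 0, 4, 0), [sr 1, r 2, sr 1, r 2, sr 1, sr 1]),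
   ((0, 0, 0, 3, 3, 0), [sr 1, sr 0, sr 1, sr 0, sr 1, sr 0]),
   ((0, 0, 4, 2, 0, 0), [r 2, r 2, sr 0, r 2, r 2, sr 0]),
   ((0, 0, 2, 0, 0, 4), [sr 2, r 2, sr 2, sr 2, sr 2, r 2]),
   ((0, 4, 0, 2, 0, 0), [r 1, sr 0, r 1, r 1, sr 0, r 1]),
   ((3, 0, 1, 0, 1, 1), [r 0, r 0, r 0, sr 2, r 2, sr 1]),
   ((0, 1, 1, 4, 0, 0), [r 2, r 1, sr 0, sr 0, sr 0, sr 0]),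
   ((0, 2, 0, 0, 1, 3), [sr 2, r 1, r 1, sr 2, sr 2, sr 1]),
   ((1, 1, 2, 1, 0, 1), [r 0, sr 0, r 2, r 2, r 1, sr 2]),
   ((2, 0, 0, 0, 4, 0), [r 0, sr 1, sr 1, r 0, sr 1, sr 1]),
   ((1, 0, 3, 1, 1, 0), [sr 0, r 2, sr 1, r 0, r 2, r 2]),
   ((0, 0, 0, 2, 0, 4), [sr 2, sr 2, sr 2, sr 0, sr 0, sr 2]),
   ((2, 0, 0, 4, 0, 0), [sr 0, sr 0, sr 0, r 0, sr 0, r 0]),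
   ((0, 2, 0, 0, 3, 1), [sr 1, sr 2, sr 1, sr 1, r 1, r 1]),
   ((0, 0, 4, 0, 2, 0), [r 2, r 2, sr 1, r 2, r 2, sr 1]),
   ((4, 0, 0, 0, 2, 0), [r 0, r 0, sr 1, r 0, r 0, sr 1]),
   ((0, 0, 2, 0, 2, 2), [sr 1, r 2, sr 2, sr 2, sr 1, r 2]),
   ((2, 0, 0, 0, 0, 4), [r 0, sr 2, sr 2, sr 2, r 0, sr 2]),
   ((2, 2, 2, 0, 0, 0), [r 0, r 2, r 2, r 1, r 0, r 1]),
   ((0, 0, 0, 2, 2, 2), [sr 2, sr 2, sr 1, sr 1, sr 0, sr 0]),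
   ((0, 0, 2, 2, 0, 2), [sr 2, sr 0, r 2, sr 2, sr 0, r 2]),
   ((3, 1, 0, 1, 0, 1), [r 0, sr 0, sr 2, r 0, r 0, r 1]),
   ((0, 4, 0, 0, 0, 2), [sr 2, r 1, r 1, sr 2, r 1, r 1]),
   ((1, 3, 0, 1, 1, 0), [r 1, sr 1, r 1, sr 0, r 0, r 1]),
   ((0, 0, 0, 2, 4, 0), [sr 1, sr 1, sr 0, sr 0, sr 1, sr 1]),
   ((3, 0, 1, 1, 1, 0), [r 0, r 0, sr 0, r 0, sr 1, r 2]),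
   ((0, 2, 0, 3, 0, 1), [sr 0, sr 0, r 1, sr 2, sr 0, r 1]),
   ((1, 0, 1, 0, 3, 1), [sr 1, sr 1, r 2, sr 1, sr 2, r 0]),
   ((1, 4, 1, 0, 0, 0), [r 1, r 1, r 1, r 0, r 1, r 2]),
   ((0, 0, 0, 4, 1, 1), [sr 0, sr 0, sr 0, sr 1, sr 0, sr 2]),
   ((0, 2, 0, 0, 4, 0), [sr 1, r 1, sr 1, r 1, sr 1, sr 1]),
   ((1, 1, 0, 0, 1, 3), [sr 2, sr 2, r 1, r 0, sr 2, sr 1]),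
   ((1, 1, 4, 0, 0, 0), [r 2, r 1, r 2, r 2, r 2, r 0]),
   ((4, 1, 1, 0, 0, 0), [r 0, r 0, r 0, r 0, r 2, r 1]),
   ((1, 1, 2, 2, 0, 0), [r 0, r 1, sr 0, r 2, r 2, sr 0]),
   ((1, 2, 1, 0, 0, 2), [r 0, r 1, r 1, sr 2, r 2, sr 2]),
   ((2, 0, 2, 0, 0, 2), [r 2, sr 2, r 0, r 2, r 0, sr 2]),
   ((0, 0, 2, 4, 0, 0), [sr 0, r 2, sr 0, sr 0, sr 0, r 2]),
   ((0, 1, 1, 1, 3, 0), [sr 1, r 1, sr 0, sr 1, sr 1, r 2]),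
   ((1, 1, 0, 2, 2, 0), [sr 0, sr 1, r 1, r 0, sr 0, sr 1]),
   ((0, 2, 0, 0, 0, 4), [sr 2, r 1, sr 2, r 1, sr 2, sr 2]),
   ((2, 0, 0, 0, 2, 2), [sr 2, r 0, r 0, sr 2, sr 1, sr 1]),
   ((2, 0, 0, 2, 0, 2), [sr 0, r 0, r 0, sr 0, sr 2, sr 2]),
   ((0, 0, 4, 1, 0, 1), [sr 0, r 2, sr 2, r 2, r 2, r 2]),
   ((0, 2, 2, 0, 2, 0), [sr 1, r 2, r 1, sr 1, r 1, r 2]),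
   ((0, 2, 2, 1, 1, 0), [r 2, sr 1, r 1, sr 0, r 1, r 2]),
   ((0, 4, 0, 1, 0, 1), [r 1, sr 0, sr 2, r 1, r 1, r 1]),
   ((2, 0, 0, 1, 2, 1), [sr 1, sr 0, sr 1, sr 2, r 0, r 0]),
   ((2, 2, 0, 0, 1, 1), [r 0, sr 1, sr 2, r 1, r 0, r 1]),
   ((0, 0, 0, 1, 1, 4), [sr 0, sr 2, sr 1, sr 2, sr 2, sr 2]),
   ((0, 0, 0, 4, 2, 0), [sr 0, sr 0, sr 1, sr 1, sr 0, sr 0]),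
   ((0, 0, 4, 0, 1, 1), [r 2, sr 2, r 2, sr 1, r 2, r 2]),
   ((0, 2, 0, 4, 0, 0), [sr 0, r 1, sr 0, sr 0, sr 0, r 1]),
   ((2, 0, 2, 1, 0, 1), [r 2, sr 0, r 0, r 0, sr 2, r 2]),
   ((2, 2, 0, 1, 1, 0), [sr 1, r 1, r 1, sr 0, r 0, r 0])]

/-- Componentwise comparison. -/
def cle : Cnt → Cnt → Bool
  | (a, b, c, d, e, f), (a', b', c', d', e', f') =>
    Nat.ble a a' && Nat.ble b b' && Nat.ble c c' && Nat.ble d d' && Nat.ble e e' && Nat.ble f f'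

/-- Bounded check on an initial segment. -/
def allLt : ℕ → (ℕ → Bool) → Bool
  | 0, _ => true
  | n + 1, p => p n && allLt n p

theorem allLt_spec {n : ℕ} {p : ℕ → Bool} (h : allLt n p = true) {k : ℕ} (hk : k < n) :
    p k = true := by
  induction n with
  | zero => omega
  | succ n ih =>
    simp only [allLt, Bool.and_eq_true] at h
    rcases Nat.lt_succ_iff_lt_or_eq.1 hk with h1 | rfl
    · exact ih h.2 h1
    · exact h.1

/-- Every count vector of total nine dominates an entry of the table. -/
def bigCheck : Bool :=
  allLt 10 fun a => allLt (10 - a) fun b => allLt (10 - a - b) fun c =>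
    allLt (10 - a - b - c) fun d => allLt (10 - a - b - c - d) fun e =>
      table.any fun t => cle t.1 (a, b, c, d, e, 9 - a - b - c - d - e)

theorem bigCheck_true : bigCheck = true := by decide +kernel

theorem table_ok : ∀ t ∈ table, t.2.prod = 1 ∧ t.2.length = 6 ∧
    (t.2.count (r 0), t.2.count (r 1), t.2.count (r 2),
      t.2.count (sr 0), t.2.count (sr 1), t.2.count (sr 2)) = t.1 := by
  decide +kernel

theorem forall_elt {p : DihedralGroup 3 → Prop} (h0 : p (r 0)) (h1 : p (r 1)) (h2 : p (r 2))
    (h3 : p (sr 0)) (h4 : p (sr 1)) (h5 : p (sr 2)) (g : DihedralGroup 3) : p g := by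
  rcases g with i | i <;> fin_cases i <;> assumption

theorem card_counts (S : Multiset (DihedralGroup 3)) :
    S.card = S.count (r 0) + S.count (r 1) + S.count (r 2) + S.count (sr 0) +
      S.count (sr 1) + S.count (sr 2) := by
  induction S using Multiset.induction_on with
  | empty => simp
  | cons a S ih =>
    rw [Multiset.card_cons, ih]
    simp only [Multiset.count_cons]
    revert a
    refine forall_elt ?_ ?_ ?_ ?_ ?_ ?_ <;>
    · simp +decide
      try omega

theorem exists_six (S : Multiset (DihedralGroup 3)) (hS : 9 ≤ S.card) :
    ∃ T ≤ S, T.card = 6 ∧ IsProductOne T := by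
  obtain ⟨S', hS', hc⟩ : ∃ S' ≤ S, S'.card = 9 := by
    induction S using Quotient.inductionOn with
    | h l =>
      refine ⟨(l.take 9 : List _), ?_, ?_⟩
      · exact (List.take_sublist 9 l).subperm
      · simpa using hS
  rw [card_counts] at hc
  have h := bigCheck_true
  unfold bigCheck at h
  have h := allLt_spec h (k := S'.count (r 0)) (by omega)
  have h := allLt_spec h (k := S'.count (r 1)) (by omega)
  have h := allLt_spec h (k := S'.count (r 2)) (by omega)
  have h := allLt_spec h (k := S'.count (sr 0)) (by omega)
  have h := allLt_spec h (k := S'.count (sr 1)) (by omega)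
  rw [List.any_eq_true] at h
  obtain ⟨t, ht, hle⟩ := h
  obtain ⟨hp, hl, hcnt⟩ := table_ok t ht
  rw [← hcnt] at hle
  simp only [cle, Bool.and_eq_true, Nat.ble_eq] at hle
  obtain ⟨⟨⟨⟨⟨l0, l1⟩, l2⟩, l3⟩, l4⟩, l5⟩ := hle
  refine ⟨(t.2 : List _), le_trans ?_ hS', by simpa using hl, t.2, rfl, hp⟩
  rw [Multiset.le_iff_count]
  refine forall_elt ?_ ?_ ?_ ?_ ?_ ?_ <;> rw [Multiset.coe_count] <;> omega

/-- The group of the statement. -/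
abbrev M := Metacyclic 2 3 (-1)

theorem relX : mcX 2 3 (-1) ^ 2 = 1 :=
  PresentedGroup.one_of_mem (rels := metacyclicRels 2 3 (-1)) (x := FreeGroup.of 0 ^ 2)
    (by simp [metacyclicRels])

theorem relY : mcY 2 3 (-1) ^ 3 = 1 :=
  PresentedGroup.one_of_mem (rels := metacyclicRels 2 3 (-1)) (x := FreeGroup.of 1 ^ 3)
    (by simp [metacyclicRels])

theorem relXY : mcY 2 3 (-1) * mcX 2 3 (-1) = mcX 2 3 (-1) * (mcY 2 3 (-1))⁻¹ := by
  have h := PresentedGroup.mk_eq_mk_of_mul_inv_mem (rels := metacyclicRels 2 3 (-1))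
    (x := FreeGroup.of 1 * FreeGroup.of 0) (y := FreeGroup.of 0 * FreeGroup.of 1 ^ (-1 : ℤ))
    (by simp [metacyclicRels])
  rw [zpow_neg_one] at h
  exact h

/-- The map to the dihedral group. -/
def phi : M →* DihedralGroup 3 :=
  PresentedGroup.toGroup (f := ![sr 0, r 1]) (by
    intro g hg
    simp only [metacyclicRels, Set.mem_insert_iff, Set.mem_singleton_iff] at hg
    rcases hg with rfl | rfl | rfl
    · simp only [map_pow, FreeGroup.lift_apply_of]; decide
    · simp only [map_pow, FreeGroup.lift_apply_of]; decide
    · simp only [map_mul, map_inv, map_zpow, FreeGroup.lift_apply_of]; decide)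

theorem phiX : phi (mcX 2 3 (-1)) = sr 0 := PresentedGroup.toGroup.of _
theorem phiY : phi (mcY 2 3 (-1)) = r 1 := PresentedGroup.toGroup.of _

/-- The inverse function. -/
def psi : DihedralGroup 3 → M
  | r i => mcY 2 3 (-1) ^ i.val
  | sr i => mcX 2 3 (-1) * mcY 2 3 (-1) ^ i.val

theorem psi_mulX (d : DihedralGroup 3) : psi (sr 0 * d) = mcX 2 3 (-1) * psi d := by
  rcases d with i | i
  · simp [psi]
  · simp only [sr_mul_sr, sub_zero, psi, ← mul_assoc]
    rw [← pow_two, relX, one_mul]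

theorem psi_mulY (d : DihedralGroup 3) : psi (r 1 * d) = mcY 2 3 (-1) * psi d := by
  have y3 := relY
  have key : ∀ i : ZMod 3, mcY 2 3 (-1) ^ (1 + i).val = mcY 2 3 (-1) * mcY 2 3 (-1) ^ i.val := by
    intro i
    rw [← pow_succ', ZMod.val_add, ← pow_mod_orderOf]
    conv_rhs => rw [← pow_mod_orderOf]
    congr 1
    have : orderOf (mcY 2 3 (-1)) ∣ 3 := orderOf_dvd_of_pow_eq_one y3
    rw [Nat.mod_mod_of_dvd _ this, add_comm]
    rfl
  rcases d with i | i
  · simp only [r_mul_r, psi, key]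
  · simp only [r_mul_sr, psi]
    rw [← mul_assoc, relXY, mul_assoc]
    congr 1
    rw [eq_inv_mul_iff_mul_eq, ← key]
    congr 2
    ring

theorem psi_phi (g : M) : psi (phi g) = g := by
  have hH : ∀ g : M, ∀ d, psi (phi g * d) = g * psi d := by
    let H : Subgroup M :=
      { carrier := {g | ∀ d, psi (phi g * d) = g * psi d}
        one_mem' := by intro d; simp
        mul_mem' := by
          intro a b ha hb d
          rw [map_mul, mul_assoc, ha, hb, mul_assoc]
        inv_mem' := by
          intro a ha d
          rw [eq_inv_mul_iff_mul_eq, ← ha, ← mul_assoc, ← map_mul]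
          simp }
    intro g
    refine PresentedGroup.generated_by _ H ?_ g
    intro j
    fin_cases j
    · intro d
      have := psi_mulX d
      rw [← phiX] at this
      exact this
    · intro d
      have := psi_mulY d
      rw [← phiY] at this
      exact this
  have := hH g 1
  rw [mul_one] at this
  rw [this]
  have h1 : psi 1 = 1 := pow_zero (mcY 2 3 (-1))
  rw [h1, mul_one]

theorem phi_psi (d : DihedralGroup 3) : phi (psi d) = d := by
  rcases d with i | i
  · simp [psi, phiY]
  · simp [psi, phiX, phiY]

/-- The isomorphism. -/
def iso : M ≃* DihedralGroup 3 :=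
  { phi with
    invFun := psi
    left_inv := psi_phi
    right_inv := phi_psi }

theorem card_M : Nat.card M = 6 := by
  rw [Nat.card_congr iso.toEquiv, DihedralGroup.nat_card]

theorem isProductOne_map {G H : Type*} [Group G] [Group H] (f : G →* H) {S : Multiset G}
    (h : IsProductOne S) : IsProductOne (S.map f) := by
  obtain ⟨l, rfl, hl⟩ := h
  exact ⟨l.map f, by simp, by rw [← map_list_prod, hl, map_one]⟩

theorem exists_six_M (S : Multiset M) (hS : 9 ≤ S.card) :
    ∃ T ≤ S, T.card = 6 ∧ IsProductOne T := by
  obtain ⟨T, hT, hc, hp⟩ := exists_six (S.map iso) (by simpa using hS)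
  refine ⟨T.map iso.symm, ?_, by simpa using hc, isProductOne_map iso.symm.toMonoidHom hp⟩
  have := Multiset.map_le_map (f := iso.symm) hT
  simpa using this

theorem filter_prod {G : Type*} [Group G] [DecidableEq G] (l : List G) :
    (l.filter (· ≠ 1)).prod = l.prod := by
  induction l with
  | nil => rfl
  | cons a l ih =>
    by_cases h : a = 1
    · simpa [h] using ih
    · simpa [h] using ih

/-- The three reflections. -/
abbrev refl3 : List (DihedralGroup 3) := [sr 0, sr 1, sr 2]

theorem small_free : (∀ a ∈ refl3, a ≠ 1) ∧ (∀ a ∈ refl3, ∀ b ∈ refl3, a ≠ b → a * b ≠ 1) ∧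
    (∀ a ∈ refl3, ∀ b ∈ refl3, ∀ c ∈ refl3, a * (b * c) ≠ 1) := by
  refine ⟨?_, ?_, ?_⟩
  · decide +kernel
  · decide +kernel
  · decide +kernel

theorem no_six (T : Multiset (DihedralGroup 3))
    (hT : T ≤ Multiset.replicate 5 1 + {sr 0, sr 1, sr 2}) (hc : T.card = 6) :
    ¬ IsProductOne T := by
  rintro ⟨l, rfl, hl⟩
  rw [← filter_prod] at hl
  have h1 := Multiset.filter_le_filter (· ≠ 1) hT
  have h2 : Multiset.filter (· ≠ 1)
      (Multiset.replicate 5 1 + {sr 0, sr 1, sr 2} : Multiset (DihedralGroup 3)) =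
      (([sr 0, sr 1, sr 2] : List (DihedralGroup 3)) : Multiset (DihedralGroup 3)) := by
    decide +kernel
  rw [h2, Multiset.filter_coe] at h1
  have hone : l.count 1 ≤ 5 := by
    have := Multiset.le_iff_count.1 hT 1
    rw [Multiset.coe_count] at this
    refine this.trans ?_
    decide +kernel
  have hlen : l.length = l.count 1 + (l.filter (· ≠ 1)).length := by
    clear * -
    induction l with
    | nil => rfl
    | cons a l ih =>
      by_cases h : a = 1
      · simp [h] at ih ⊢; omega
      · simp [h] at ih ⊢; omega
  have hc' : l.length = 6 := by simpa using hc
  generalize hm : l.filter (· ≠ 1) = m at *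
  have hml : m.length ≤ 3 := by simpa using Multiset.card_le_card h1
  have hmem : ∀ a ∈ m, a ∈ [sr 0, sr 1, sr 2] := fun a ha => by
    have := Multiset.mem_of_le h1 (Multiset.mem_coe.2 ha)
    exact Multiset.mem_coe.1 this
  have hnd : m.Nodup := by
    have := Multiset.nodup_of_le h1 (by decide)
    exact Multiset.coe_nodup.1 this
  obtain ⟨s1, s2, s3⟩ := small_free
  match m, hml, hmem, hnd, hl, hlen with
  | [], _, _, _, _, hlen => simp at hlen; omega
  | [a], _, hmem, _, hl, _ => exact s1 a (hmem a (by simp)) (by simpa using hl)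
  | [a, b], _, hmem, hnd, hl, _ =>
    exact s2 a (hmem a (by simp)) b (hmem b (by simp)) (by simpa using hnd) (by simpa using hl)
  | [a, b, c], _, hmem, hnd, hl, _ =>
    exact s3 a (hmem a (by simp)) b (hmem b (by simp)) c (hmem c (by simp)) (by simpa using hl)
  | _ :: _ :: _ :: _ :: _, h, _, _, _, _ => simp at h; omega

end DihedralSix

/-- In `G_{2,3,-1}` (the dihedral group of order 6), the sequence
`S = 1^[5] ⬝ x ⬝ xy ⬝ xy²` has length `8 = E(G_{2,3,-1}) - 1` and contains no
product-one subsequence of length `6`. -/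
theorem dihedral_six_exceptional_sequence :
    Multiset.card
        (Multiset.replicate 5 (1 : Metacyclic 2 3 (-1)) +
          {mcX 2 3 (-1), mcX 2 3 (-1) * mcY 2 3 (-1), mcX 2 3 (-1) * mcY 2 3 (-1) ^ 2}) = 8 ∧
    8 = gaoConstant (Metacyclic 2 3 (-1)) - 1 ∧
    ∀ T : Multiset (Metacyclic 2 3 (-1)),
      T ≤ Multiset.replicate 5 (1 : Metacyclic 2 3 (-1)) +
            {mcX 2 3 (-1), mcX 2 3 (-1) * mcY 2 3 (-1), mcX 2 3 (-1) * mcY 2 3 (-1) ^ 2} →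
      Multiset.card T = 6 → ¬ IsProductOne T := by
  have h3 : ∀ T : Multiset (Metacyclic 2 3 (-1)),
      T ≤ Multiset.replicate 5 (1 : Metacyclic 2 3 (-1)) +
            {mcX 2 3 (-1), mcX 2 3 (-1) * mcY 2 3 (-1), mcX 2 3 (-1) * mcY 2 3 (-1) ^ 2} →
      Multiset.card T = 6 → ¬ IsProductOne T := by
    intro T hT hc hp
    refine DihedralSix.no_six (T.map DihedralSix.phi) ?_ (by simpa using hc)
      (DihedralSix.isProductOne_map _ hp)
    have := Multiset.map_le_map (f := DihedralSix.phi) hT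
    simpa [DihedralSix.phiX, DihedralSix.phiY] using this
  refine ⟨by simp, ?_, h3⟩
  have hmem : 9 ∈ {ℓ : ℕ | 0 < ℓ ∧ ∀ S : Multiset (Metacyclic 2 3 (-1)), ℓ ≤ Multiset.card S →
      ∃ T : Multiset (Metacyclic 2 3 (-1)), T ≤ S ∧
        Multiset.card T = Nat.card (Metacyclic 2 3 (-1)) ∧ IsProductOne T} := by
    refine ⟨by norm_num, fun S hS => ?_⟩
    rw [DihedralSix.card_M]
    exact DihedralSix.exists_six_M S hS
  have h9 : gaoConstant (Metacyclic 2 3 (-1)) = 9 := by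
    refine le_antisymm (Nat.sInf_le hmem) (le_csInf ⟨9, hmem⟩ ?_)
    rintro k ⟨-, hk⟩
    by_contra hlt
    obtain ⟨T, hT, hc, hp⟩ := hk (Multiset.replicate 5 (1 : Metacyclic 2 3 (-1)) +
      {mcX 2 3 (-1), mcX 2 3 (-1) * mcY 2 3 (-1), mcX 2 3 (-1) * mcY 2 3 (-1) ^ 2})
      (by simp; omega)
    rw [DihedralSix.card_M] at hc
    exact h3 T hT hc hp
  rw [h9]
end
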